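/- Let n ≥ 1 and let A ∈ ℝmax^{n×n} be such that 𝒟(A) contains at least one cycle (so λ(A) ≠ −∞). Let B^{ct} be obtained from A by the cycle threshold scheme, and let ĉ = ĉ(𝒟(A)) be the circumference and cd = cd(𝒟(A)) the cab driver's diameter of 𝒟(A). Then T_1(A,B^{ct}) ≤ (n−1)ĉ + min(n, cd + ĉ + 1) and T_1(A,B^{ct}) ≤ (cd + ĉ − 1)ĉ + cd + 1. -/

import Mathlib

open Classical

noncomputable section

namespace MaxPlus

/-- A square matrix over the max-plus semiring `ℝmax = ℝ ∪ {-∞}`,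
represented as `WithBot ℝ` (with `⊥ = -∞`, `+` the usual addition). -/
abbrev MPMat (n : ℕ) := Fin n → Fin n → WithBot ℝ

variable {n : ℕ}

/-- Max-plus matrix multiplication: `(A⊗B)_{ij} = max_k (a_{ik} + b_{kj})`. -/
def mpMul (A B : MPMat n) : MPMat n := fun i j => Finset.univ.sup fun k => A i k + B k j

/-- Max-plus matrix power, with `A^0` the max-plus identity. -/
def mpPow (A : MPMat n) : ℕ → MPMat n
  | 0 => fun i j => if i = j then (0 : WithBot ℝ) else ⊥
  | t + 1 => mpMul A (mpPow A t)

/-- Max-plus matrix-vector product. -/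
def mpMulVec (A : MPMat n) (x : Fin n → WithBot ℝ) : Fin n → WithBot ℝ :=
  fun i => Finset.univ.sup fun k => A i k + x k

/-- A digraph on the node set `{1,…,n}`: a set of vertices together with an
edge relation. -/
structure SubD (n : ℕ) where
  verts : Set (Fin n)
  edge : Fin n → Fin n → Prop

/-- The weighted digraph `𝒟(A)` of a max-plus matrix: all `n` nodes, with an
edge `(i,j)` whenever `a_{ij} ≠ -∞`. -/
def digr (A : MPMat n) : SubD n := ⟨Set.univ, fun i j => A i j ≠ ⊥⟩

/-- `W` (a nonempty list of nodes) is a walk in the digraph `G`. -/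
def IsWalkIn (G : SubD n) (W : List (Fin n)) : Prop :=
  W ≠ [] ∧ (∀ v ∈ W, v ∈ G.verts) ∧ W.Chain' G.edge

/-- The length of a walk: its number of edges (number of nodes minus one). -/
def elen (W : List (Fin n)) : ℕ := W.length - 1

/-- The weight `p(W)` of a walk: sum of the weights of its edges. -/
def walkWeight (A : MPMat n) (W : List (Fin n)) : WithBot ℝ :=
  ((W.zip W.tail).map fun p => A p.1 p.2).sum

/-- `W` is a cycle in `G`: a nonempty closed walk with pairwise distinct
nodes (apart from the repeated endpoint). -/
def IsCycleIn (G : SubD n) (W : List (Fin n)) : Prop :=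
  IsWalkIn G W ∧ 2 ≤ W.length ∧ W.head? = W.getLast? ∧ W.dropLast.Nodup

/-- `W` is a path in `G`: a walk with no repeated node. -/
def IsPathIn (G : SubD n) (W : List (Fin n)) : Prop :=
  IsWalkIn G W ∧ W.Nodup

/-- `v` is reachable from `u` by a (possibly empty) walk in `G`. -/
def ReachIn (G : SubD n) (u v : Fin n) : Prop :=
  ∃ W, IsWalkIn G W ∧ W.head? = some u ∧ W.getLast? = some v

/-- `u` and `v` lie in the same strongly connected component of `G`. -/
def SccEq (G : SubD n) (u v : Fin n) : Prop := ReachIn G u v ∧ ReachIn G v u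

/-- The node set of the s.c.c. of `u` in `G`. -/
def sccOf (G : SubD n) (u : Fin n) : Set (Fin n) := {v | SccEq G u v}

/-- The s.c.c. of `u` in `G`, as a digraph. -/
def sccSub (G : SubD n) (u : Fin n) : SubD n :=
  ⟨sccOf G u, fun a b => G.edge a b ∧ a ∈ sccOf G u ∧ b ∈ sccOf G u⟩

/-- `H` is a subgraph of `G`. -/
def SubLE (H G : SubD n) : Prop := H.verts ⊆ G.verts ∧ ∀ u v, H.edge u v → G.edge u v

/-- `G` is completely reducible: there are no edges between distinct s.c.c.'s,
i.e. every edge lies inside an s.c.c. -/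
def CompletelyReducible (G : SubD n) : Prop := ∀ u v, G.edge u v → ReachIn G v u

/-- `G` has no trivial s.c.c.: every node lies on a cycle of `G`. -/
def NoTrivialScc (G : SubD n) : Prop := ∀ v ∈ G.verts, ∃ W, IsCycleIn G W ∧ v ∈ W

/-- `A` is irreducible: `𝒟(A)` is strongly connected. -/
def IrreducibleMat (A : MPMat n) : Prop := ∀ i j : Fin n, ReachIn (digr A) i j

/-- `W` is a closed walk at node `v` in `G`. -/
def IsClosedWalkAt (G : SubD n) (v : Fin n) (W : List (Fin n)) : Prop :=
  IsWalkIn G W ∧ W.head? = some v ∧ W.getLast? = some v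

/-- The greatest common divisor of a set of naturals (0 for the empty set). -/
def setGcd (S : Set ℕ) : ℕ :=
  sInf {d | (∀ s ∈ S, d ∣ s) ∧ ∀ e, (∀ s ∈ S, e ∣ s) → e ∣ d}

/-- The least common multiple of a set of naturals: the least positive common
multiple (0 if there is none). -/
def setLcm (S : Set ℕ) : ℕ := sInf {m | 0 < m ∧ ∀ s ∈ S, s ∣ m}

/-- The cyclicity of the s.c.c. of `v` in `G`: the gcd of the lengths of the
closed walks of `G` through `v` (0 if `v` lies on no nonempty closed walk). -/
def sccCyclicity (G : SubD n) (v : Fin n) : ℕ :=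
  setGcd {l | 0 < l ∧ ∃ W, IsClosedWalkAt G v W ∧ elen W = l}

/-- The cyclicity of a digraph: the lcm of the cyclicities of its
(nontrivial) s.c.c.'s. -/
def graphCyclicity (G : SubD n) : ℕ :=
  setLcm {c | ∃ v ∈ G.verts, c = sccCyclicity G v ∧ 0 < c}

/-- The walk `W` has mean weight `m`, i.e. `p(W) = l(W)·m` (finitely). -/
def meanIs (A : MPMat n) (W : List (Fin n)) (m : ℝ) : Prop :=
  walkWeight A W = (((elen W : ℝ) * m : ℝ) : WithBot ℝ)

/-- `lam` is the maximum cycle mean `λ(A)` of `A`: it is the mean of some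
cycle of `𝒟(A)` and no cycle has a larger mean.  (Its existence is
equivalent to `𝒟(A)` containing a cycle, i.e. `λ(A) ≠ -∞`.) -/
def IsMaxCycleMean (A : MPMat n) (lam : ℝ) : Prop :=
  (∃ W, IsCycleIn (digr A) W ∧ meanIs A W lam) ∧
  ∀ W m, IsCycleIn (digr A) W → meanIs A W m → m ≤ lam

/-- The set of critical nodes: nodes on some cycle of mean `λ(A)`. -/
def critNodes (A : MPMat n) (lam : ℝ) : Set (Fin n) :=
  {v | ∃ W, IsCycleIn (digr A) W ∧ meanIs A W lam ∧ v ∈ W}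

/-- Critical edges: edges of some cycle of mean `λ(A)`. -/
def critEdges (A : MPMat n) (lam : ℝ) (u v : Fin n) : Prop :=
  ∃ W, IsCycleIn (digr A) W ∧ meanIs A W lam ∧ (u, v) ∈ W.zip W.tail

/-- The critical graph `𝒞(A)`. -/
def critSub (A : MPMat n) (lam : ℝ) : SubD n := ⟨critNodes A lam, critEdges A lam⟩

/-- Add the real constant `c` to every entry. -/
def shiftMat (A : MPMat n) (c : ℝ) : MPMat n := fun i j => A i j + (c : WithBot ℝ)

/-- The max-plus Kleene star `X^* = I ⊕ X ⊕ X² ⊕ ⋯` (entrywise supremum). -/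
def mpStar (X : MPMat n) : MPMat n := fun i j => ⨆ t : ℕ, mpPow X t i j

/-- The matrix `M = (((-λ)⊗A)^{γ(𝒢)})^*` used to define the CSR terms. -/
def csrM (A : MPMat n) (lam : ℝ) (G : SubD n) : MPMat n :=
  mpStar (mpPow (shiftMat A (-lam)) (graphCyclicity G))

/-- The `C` term of the CSR expansion of `A` w.r.t. the subgraph `G`. -/
def csrC (A : MPMat n) (lam : ℝ) (G : SubD n) : MPMat n :=
  fun i j => if j ∈ G.verts then csrM A lam G i j else ⊥

/-- The `R` term of the CSR expansion of `A` w.r.t. the subgraph `G`. -/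
def csrR (A : MPMat n) (lam : ℝ) (G : SubD n) : MPMat n :=
  fun i j => if i ∈ G.verts then csrM A lam G i j else ⊥

/-- The `S` term of the CSR expansion of `A` w.r.t. the subgraph `G`. -/
def csrS (A : MPMat n) (lam : ℝ) (G : SubD n) : MPMat n :=
  fun i j => if G.edge i j then A i j + ((-lam : ℝ) : WithBot ℝ) else ⊥

/-- The matrix `C S^t R`. -/
def csr (A : MPMat n) (lam : ℝ) (G : SubD n) (t : ℕ) : MPMat n :=
  mpMul (mpMul (csrC A lam G) (mpPow (csrS A lam G) t)) (csrR A lam G)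

/-- `G` is a representing subgraph of the critical graph `crit`: a completely
reducible subgraph (with no trivial s.c.c.) such that every s.c.c. of `crit`
contains exactly one s.c.c. of `G`. -/
structure IsRepresenting (crit G : SubD n) : Prop where
  le : SubLE G crit
  compRed : CompletelyReducible G
  noTriv : NoTrivialScc G
  covers : ∀ u ∈ crit.verts, ∃ v ∈ G.verts, SccEq crit u v
  unique : ∀ v ∈ G.verts, ∀ w ∈ G.verts, SccEq crit v w → SccEq G v w

/-- `B` is subordinate to `A`: obtained from `A` by setting some entries to `-∞`. -/
def Subordinate (B A : MPMat n) : Prop := ∀ i j, B i j = A i j ∨ B i j = ⊥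

/-- Set to `-∞` all entries in the rows and columns indexed by `S`. -/
def zeroRC (A : MPMat n) (S : Set (Fin n)) : MPMat n :=
  fun i j => if i ∈ S ∨ j ∈ S then ⊥ else A i j

/-- The Nachtigall scheme: zero out the rows and columns of critical nodes. -/
def bN (A : MPMat n) (lam : ℝ) : MPMat n := zeroRC A (critNodes A lam)

/-- `V` is a max-balancing of `A`: `V = D⁻¹((-λ(A))⊗A)D` with all entries `≤ 0`,
entries `0` on critical edges, and every edge of `𝒟(V)` lies on a cycle all of
whose edges have weight at least that of the given edge (cycle cover). -/
def IsMaxBalancing (A : MPMat n) (lam : ℝ) (V : MPMat n) : Prop :=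
  (∃ d : Fin n → ℝ, ∀ i j, V i j = A i j + ((d j - d i - lam : ℝ) : WithBot ℝ)) ∧
  (∀ i j, V i j ≤ (0 : WithBot ℝ)) ∧
  (∀ i j, critEdges A lam i j → V i j = (0 : WithBot ℝ)) ∧
  (∀ i j, V i j ≠ ⊥ →
    ∃ W, IsCycleIn (digr V) W ∧ (i, j) ∈ W.zip W.tail ∧ ∀ p ∈ W.zip W.tail, V i j ≤ V p.1 p.2)

/-- The Hartmann-Arguelles threshold graph `Θ^{ha}(μ)`: induced by the edges
with `v_{ij} ≥ μ`; by convention `Θ^{ha}(-∞) = 𝒟(A)`. -/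
def thrHA (A V : MPMat n) (μ : WithBot ℝ) : SubD n :=
  if μ = ⊥ then digr A
  else ⟨{u | ∃ w, μ ≤ V u w ∨ μ ≤ V w u}, fun u v => μ ≤ V u v⟩

/-- The cycle threshold graph `Θ^{ct}(μ)`: induced by all nodes and edges of
cycles of mean weight `≥ μ`; by convention `Θ^{ct}(-∞) = 𝒟(A)`. -/
def thrCT (A : MPMat n) (μ : WithBot ℝ) : SubD n :=
  if μ = ⊥ then digr A
  else ⟨{v | ∃ W m, IsCycleIn (digr A) W ∧ meanIs A W m ∧ μ ≤ (m : WithBot ℝ) ∧ v ∈ W},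
        fun u v => ∃ W m, IsCycleIn (digr A) W ∧ meanIs A W m ∧ μ ≤ (m : WithBot ℝ) ∧
          (u, v) ∈ W.zip W.tail⟩

/-- `Θ` has an s.c.c. containing no s.c.c. of `crit`. -/
def HasFreeScc (Θ crit : SubD n) : Prop :=
  ∃ u ∈ Θ.verts, ¬ ∃ w ∈ crit.verts, sccOf crit w ⊆ sccOf Θ u

/-- `μ` is the greatest value `≤ λ(A)` satisfying `P` (or `-∞` if there is
no such value). -/
def IsThrMax (P : WithBot ℝ → Prop) (lam : ℝ) (μ : WithBot ℝ) : Prop :=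
  (μ ≤ (lam : WithBot ℝ) ∧ P μ ∧ ∀ μ', μ' ≤ (lam : WithBot ℝ) → P μ' → μ' ≤ μ) ∨
  (μ = ⊥ ∧ ∀ μ', μ' ≤ (lam : WithBot ℝ) → ¬ P μ')

/-- `μ = μ^{ha}` for the max-balancing `V` of `A`. -/
def IsMuHA (A : MPMat n) (lam : ℝ) (V : MPMat n) (μ : WithBot ℝ) : Prop :=
  IsThrMax (fun m => HasFreeScc (thrHA A V m) (critSub A lam)) lam μ

/-- `μ = μ^{ct}` for `A`. -/
def IsMuCT (A : MPMat n) (lam : ℝ) (μ : WithBot ℝ) : Prop :=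
  IsThrMax (fun m => HasFreeScc (thrCT A m) (critSub A lam)) lam μ

/-- The union of the s.c.c.'s of `Θ` intersecting the node set `crit`. -/
def unionSccMeeting (Θ : SubD n) (crit : Set (Fin n)) : Set (Fin n) :=
  {v | v ∈ Θ.verts ∧ ∃ w ∈ crit, SccEq Θ v w}

/-- The node set `𝒢^{ha}` of the Hartmann-Arguelles scheme. -/
def haNodes (A V : MPMat n) (lam : ℝ) (μ : WithBot ℝ) : Set (Fin n) :=
  unionSccMeeting (thrHA A V μ) (critNodes A lam)

/-- The matrix `B^{HA}` of the Hartmann-Arguelles scheme. -/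
def bHA (A V : MPMat n) (lam : ℝ) (μ : WithBot ℝ) : MPMat n :=
  zeroRC A (haNodes A V lam μ)

/-- The node set `𝒢^{ct}` of the cycle threshold scheme. -/
def ctNodes (A : MPMat n) (lam : ℝ) (μ : WithBot ℝ) : Set (Fin n) :=
  unionSccMeeting (thrCT A μ) (critNodes A lam)

/-- The matrix `B^{ct}` of the cycle threshold scheme. -/
def bCT (A : MPMat n) (lam : ℝ) (μ : WithBot ℝ) : MPMat n :=
  zeroRC A (ctNodes A lam μ)

/-- The graph `𝒢^{ct}`: the union of the s.c.c.'s of `Θ^{ct}(μ^{ct})`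
intersecting `𝒞(A)`, as a digraph. -/
def ctSub (A : MPMat n) (lam : ℝ) (μ : WithBot ℝ) : SubD n :=
  ⟨ctNodes A lam μ,
   fun u v => (thrCT A μ).edge u v ∧ u ∈ ctNodes A lam μ ∧ v ∈ ctNodes A lam μ⟩

/-- The circumference of `G`: the greatest length of a cycle of `G`. -/
def circumf (G : SubD n) : ℕ := sSup {l | ∃ W, IsCycleIn G W ∧ W.length = l + 1}

/-- The cab driver's diameter of `G`: the greatest length of a path of `G`. -/
def cabDiam (G : SubD n) : ℕ := sSup {l | ∃ W, IsPathIn G W ∧ W.length = l + 1}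

/-- The girth of the s.c.c. of `v` in `G`: the least length of a cycle lying
in the s.c.c. of `v`. -/
def sccGirth (G : SubD n) (v : Fin n) : ℕ :=
  sInf {l | 0 < l ∧ ∃ W, IsCycleIn G W ∧ W.length = l + 1 ∧ ∀ u ∈ W, SccEq G v u}

/-- The max-girth of `G`: the greatest girth of an s.c.c. of `G`. -/
def maxGirth (G : SubD n) : ℕ := sSup {g | ∃ v ∈ G.verts, 0 < g ∧ g = sccGirth G v}

/-- The max-cyclicity of `G`: the greatest cyclicity of an s.c.c. of `G`. -/
def maxCyclicity (G : SubD n) : ℕ := sSup {c | ∃ v ∈ G.verts, 0 < c ∧ c = sccCyclicity G v}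

/-- The Wielandt number: `Wi(n) = (n-1)² + 1` for `n > 1`, `Wi(1) = 0`. -/
def wielandt (k : ℕ) : ℕ := if k ≤ 1 then 0 else (k - 1) ^ 2 + 1

/-- The set of finite entries of `A`. -/
def finEntries (A : MPMat n) : Set ℝ := {x | ∃ i j, A i j = (x : WithBot ℝ)}

/-- The least finite entry of `A`. -/
def minEnt (A : MPMat n) : ℝ := sInf (finEntries A)

/-- The greatest finite entry of `A`. -/
def maxEnt (A : MPMat n) : ℝ := sSup (finEntries A)

/-- `‖A‖`: the difference between the greatest and least finite entries. -/
def matNorm (A : MPMat n) : ℝ := maxEnt A - minEnt A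

/-- `n_B`: the size of the smallest square submatrix of `B` containing all
finite entries of `B`. -/
def nB (B : MPMat n) : ℕ := Set.ncard {i | ∃ j, B i j ≠ ⊥ ∨ B j i ≠ ⊥}

/-- `‖v‖`: the difference between the greatest and least entries of `v`. -/
def vecNorm (v : Fin n → ℝ) : ℝ := sSup (Set.range v) - sInf (Set.range v)

/-- The exploration penalty `ep^γ(i)` (w.r.t. the graph `crit`): the least `T`
such that for every multiple `t` of `γ` with `t ≥ T` there is a closed walk of
length `t` at `i` in `crit`. -/
def epAt (crit : SubD n) (γ : ℕ) (i : Fin n) : ℕ :=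
  sInf {T | ∀ t, γ ∣ t → T ≤ t → ∃ W, IsClosedWalkAt crit i W ∧ elen W = t}

/-- The exploration penalty `ep^γ(S)`: the maximum of `ep^γ(i)` over `i ∈ S`. -/
def epOn (crit : SubD n) (γ : ℕ) (S : Set (Fin n)) : ℕ := sSup {e | ∃ i ∈ S, e = epAt crit γ i}

/-- `ep(𝒞(A))`: the maximum over the s.c.c.'s `𝒞_l` of `crit` of
`ep^{γ(𝒞_l)}(𝒞_l)`. -/
def epCrit (crit : SubD n) : ℕ :=
  sSup {e | ∃ i ∈ crit.verts, e = epAt crit (sccCyclicity crit i) i}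

/-- The weak CSR expansion `A^t = λ^{⊗t}⊗(CS^tR) ⊕ B^t` holds at time `t`
(with CSR terms taken w.r.t. the subgraph `G`). -/
def weakCSReq (A B : MPMat n) (lam : ℝ) (G : SubD n) (t : ℕ) : Prop :=
  ∀ i j, mpPow A t i j = max (csr A lam G t i j + (((t : ℝ) * lam : ℝ) : WithBot ℝ)) (mpPow B t i j)

/-- The domination `λ^{⊗t}⊗(CS^tR) ≥ B^t` holds at time `t`. -/
def T2eq (A B : MPMat n) (lam : ℝ) (G : SubD n) (t : ℕ) : Prop :=
  ∀ i j, mpPow B t i j ≤ csr A lam G t i j + (((t : ℝ) * lam : ℝ) : WithBot ℝ)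

/-- The domination `λ^{⊗t}⊗(CS^tRv) ≥ B^t v` holds at time `t`. -/
def T2veq (A B : MPMat n) (lam : ℝ) (G : SubD n) (v : Fin n → ℝ) (t : ℕ) : Prop :=
  ∀ i, mpMulVec (mpPow B t) (fun j => (v j : WithBot ℝ)) i
      ≤ mpMulVec (csr A lam G t) (fun j => (v j : WithBot ℝ)) i + (((t : ℝ) * lam : ℝ) : WithBot ℝ)

/-- One step of removing a (nonempty) closed subwalk from a walk. -/
def RemoveStep (W V : List (Fin n)) : Prop :=
  ∃ (pre mid post : List (Fin n)) (x : Fin n),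
    W = pre ++ x :: mid ++ x :: post ∧ V = pre ++ x :: post

/-- One step of inserting a cycle of `C` into a walk (at an occurrence of a
node of that cycle). -/
def InsertStep (C : SubD n) (W V : List (Fin n)) : Prop :=
  ∃ (pre post mid : List (Fin n)) (x : Fin n),
    W = pre ++ x :: post ∧ V = pre ++ x :: mid ++ x :: post ∧ IsCycleIn C (x :: mid ++ [x])

/-- `V` is obtained from `W` by removing cycles. -/
def RemOnly : List (Fin n) → List (Fin n) → Prop := Relation.ReflTransGen RemoveStep

/-- `V` is obtained from `W` by removing cycles and possibly inserting cycles
of `C`. -/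
def RemIns (C : SubD n) : List (Fin n) → List (Fin n) → Prop :=
  Relation.ReflTransGen fun W V => RemoveStep W V ∨ InsertStep C W V

/-- `V` is obtained from `W` by removing at least one cycle and possibly
inserting cycles of `C`. -/
def RemInsStrict (C : SubD n) (W V : List (Fin n)) : Prop :=
  ∃ W₁ W₂, RemIns C W W₁ ∧ RemoveStep W₁ W₂ ∧ RemIns C W₂ V

/-- `T` witnesses the cycle removal threshold `T_cr^γ(C) ≤ T` in the digraph
`G`: every walk of `G` through `C` of length `≥ T` can be reduced (removing
cycles, possibly inserting cycles of `C`) to a walk through `C` with the same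
endpoints, the same length mod `γ`, and length `≤ T`. -/
def TcrProp (G C : SubD n) (γ T : ℕ) : Prop :=
  ∀ W, IsWalkIn G W → (∃ v ∈ C.verts, v ∈ W) → T ≤ elen W →
    ∃ V, RemIns C W V ∧ IsWalkIn G V ∧ (∃ v ∈ C.verts, v ∈ V) ∧
      V.head? = W.head? ∧ V.getLast? = W.getLast? ∧ elen V ≡ elen W [MOD γ] ∧ elen V ≤ T

/-- `T` witnesses the strict cycle removal threshold `T̃_cr^γ(C) ≤ T`. -/
def TcrStrictProp (G C : SubD n) (γ T : ℕ) : Prop :=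
  ∀ W, IsWalkIn G W → (∃ v ∈ C.verts, v ∈ W) → T ≤ elen W →
    ∃ V, RemInsStrict C W V ∧ IsWalkIn G V ∧ (∃ v ∈ C.verts, v ∈ V) ∧
      V.head? = W.head? ∧ V.getLast? = W.getLast? ∧ elen V ≡ elen W [MOD γ] ∧ elen V ≤ T

/-- The cycle removal threshold `T_cr^γ(C)` of the subgraph `C` in `G`. -/
def Tcr (G C : SubD n) (γ : ℕ) : ℕ := sInf {T | TcrProp G C γ T}

/-- The strict cycle removal threshold `T̃_cr^γ(C)` of the subgraph `C` in `G`. -/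
def TcrStrict (G C : SubD n) (γ : ℕ) : ℕ := sInf {T | TcrStrictProp G C γ T}

/-- The subgraph formed by the nodes and edges of the walk `W`. -/
def cycleSub (W : List (Fin n)) : SubD n :=
  ⟨{v | v ∈ W}, fun a b => (a, b) ∈ W.zip W.tail⟩

/-- The single-node subgraph `{i}` (with no edges). -/
def singleSub (i : Fin n) : SubD n := ⟨{i}, fun _ _ => False⟩

/-- `λ(M)` as an element of `ℝmax` (`-∞` if `𝒟(M)` has no cycle). -/
def lamW (M : MPMat n) : WithBot ℝ :=
  sSup {x : WithBot ℝ | ∃ W m, IsCycleIn (digr M) W ∧ meanIs M W m ∧ x = (m : WithBot ℝ)}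

end MaxPlus

namespace MaxPlus

/-- walk predicate -/
inductive Wk {n : ℕ} (A : MPMat n) : Fin n → Fin n → ℕ → ℝ → Prop
  | nil (i : Fin n) : Wk A i i 0 0
  | cons {i j k : Fin n} {t : ℕ} {x : ℝ} (a : ℝ) (h : A i j = (a : WithBot ℝ))
      (hw : Wk A j k t x) : Wk A i k (t + 1) (a + x)

/-- functional walk: nodes `w`, prefix weights `y`, length `t`. -/
def Fw {n : ℕ} (A : MPMat n) (t : ℕ) (w : ℕ → Fin n) (y : ℕ → ℝ) : Prop :=
  ∀ k < t, A (w k) (w (k + 1)) = ((y (k + 1) - y k : ℝ) : WithBot ℝ)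

theorem Wk.cast {n : ℕ} {A : MPMat n} {i j : Fin n} {t t' : ℕ} {x x' : ℝ} (h : Wk A i j t x)
    (ht : t = t') (hx : x = x') : Wk A i j t' x' := by subst ht; subst hx; exact h

theorem Wk.trans {n : ℕ} {A : MPMat n} {i j k : Fin n} {t t' : ℕ} {x x' : ℝ} (h : Wk A i j t x)
    (h' : Wk A j k t' x') : Wk A i k (t + t') (x + x') := by
  induction h with
  | nil i => simpa using h'
  | cons a ha _ ih => exact ((ih h').cons a ha).cast (by ring) (by ring)

theorem Wk.single {n : ℕ} {A : MPMat n} {i j : Fin n} {a : ℝ} (h : A i j = (a : WithBot ℝ)) :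
    Wk A i j 1 a := ((Wk.nil j).cons a h).cast (by simp) (by simp)

theorem Wk.mono {n : ℕ} {A B : MPMat n} {i j : Fin n} {t : ℕ} {x : ℝ} (h : Wk A i j t x)
    (hAB : ∀ i j (a : ℝ), A i j = (a : WithBot ℝ) → B i j = (a : WithBot ℝ)) : Wk B i j t x := by
  induction h with
  | nil i => exact .nil i
  | cons a ha _ ih => exact ih.cons a (hAB _ _ _ ha)

theorem Wk.shift {n : ℕ} {A : MPMat n} {i j : Fin n} {t : ℕ} {x : ℝ} (h : Wk A i j t x) (c : ℝ) :
    Wk (shiftMat A c) i j t (x + t * c) := by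
  induction h with
  | nil i => exact (Wk.nil i).cast rfl (by simp)
  | cons a ha _ ih =>
    refine (ih.cons (a + c) ?_).cast rfl (by push_cast; ring)
    simp [shiftMat, ha]

theorem shift_shift {n : ℕ} (A : MPMat n) (c : ℝ) : shiftMat (shiftMat A c) (-c) = A := by
  funext i j
  simp only [shiftMat]
  rcases h : A i j with _ | a
  · rfl
  · change ((a + c + -c : ℝ) : WithBot ℝ) = (a : WithBot ℝ)
    simp

theorem Wk.unshift {n : ℕ} {A : MPMat n} {i j : Fin n} {t : ℕ} {x c : ℝ}
    (h : Wk (shiftMat A c) i j t x) : Wk A i j t (x - t * c) := by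
  have := h.shift (-c)
  rw [shift_shift] at this
  exact this.cast rfl (by ring)

theorem Wk.nsmul {n : ℕ} {A : MPMat n} {i : Fin n} {t : ℕ} {x : ℝ} (h : Wk A i i t x) (k : ℕ) :
    Wk A i i (k * t) (k * x) := by
  induction k with
  | zero => exact (Wk.nil i).cast (by simp) (by simp)
  | succ k ih => exact (ih.trans h).cast (by ring) (by push_cast; ring)

theorem Fw.seg {n : ℕ} {A : MPMat n} {t : ℕ} {w : ℕ → Fin n} {y : ℕ → ℝ} (h : Fw A t w y)
    {s e : ℕ} (hse : s ≤ e) (he : e ≤ t) : Wk A (w s) (w e) (e - s) (y e - y s) := by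
  induction e, hse using Nat.le_induction with
  | base => exact (Wk.nil _).cast (by simp) (by simp)
  | succ e hse ih =>
    exact ((ih (by omega)).trans (Wk.single (h e (by omega)))).cast (by omega) (by ring)

theorem Wk.fn_app {n : ℕ} {A : MPMat n} {i j : Fin n} {t : ℕ} {x : ℝ} (h : Wk A i j t x) :
    ∀ (q : ℕ) (w2 : ℕ → Fin n) (y2 : ℕ → ℝ), Fw A q w2 y2 → w2 0 = j → y2 0 = 0 →
    ∃ w y, Fw A (t + q) w y ∧ w 0 = i ∧ y 0 = 0 ∧ (∀ k, w (t + k) = w2 k) ∧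
      (∀ k, y (t + k) = x + y2 k) := by
  induction h with
  | nil i =>
    intro q w2 y2 h h0 hy
    exact ⟨w2, y2, by simpa using h, h0, hy, by simp, by simp⟩
  | @cons i j k t x a ha _ ih =>
    intro q w2 y2 h h0 hy
    obtain ⟨w, y, hF, hw0, hy0, hw, hy'⟩ := ih q w2 y2 h h0 hy
    refine ⟨fun k => Nat.casesOn k i w, fun k => Nat.casesOn k 0 (fun k => a + y k), ?_, rfl, rfl,
      ?_, ?_⟩
    · intro k hk
      cases k with
      | zero => simp [hw0, hy0, ha]
      | succ k =>
        have := hF k (by omega)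
        simp only [this]
        congr 1
        ring
    · intro k
      rw [show t + 1 + k = (t + k) + 1 by ring]
      exact hw k
    · intro k
      rw [show t + 1 + k = (t + k) + 1 by ring]
      change a + y (t + k) = _
      rw [hy']; ring

theorem Wk.fn {n : ℕ} {A : MPMat n} {i j : Fin n} {t : ℕ} {x : ℝ} (h : Wk A i j t x) :
    ∃ w y, Fw A t w y ∧ w 0 = i ∧ y 0 = 0 ∧ w t = j ∧ y t = x := by
  obtain ⟨w, y, h1, h2, h3, h4, h5⟩ := h.fn_app 0 (fun _ => j) (fun _ => 0)
    (by intro k hk; omega) rfl rfl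
  exact ⟨w, y, h1, h2, h3, by simpa using h4 0, by simpa using h5 0⟩

theorem Wk.fn2 {n : ℕ} {A : MPMat n} {i j v : Fin n} {p q : ℕ} {x1 x2 : ℝ} (h : Wk A i v p x1)
    (h' : Wk A v j q x2) :
    ∃ w y, Fw A (p + q) w y ∧ w 0 = i ∧ y 0 = 0 ∧ w p = v ∧ w (p + q) = j ∧ y (p + q) = x1 + x2 := by
  obtain ⟨w2, y2, h1, h2, h3, h4, h5⟩ := h'.fn
  obtain ⟨w, y, g1, g2, g3, g4, g5⟩ := h.fn_app q w2 y2 h1 h2 h3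
  exact ⟨w, y, g1, g2, g3, by simpa [h2] using g4 0, by rw [g4, h4], by rw [g5, h5]⟩

theorem Wk.split {n : ℕ} {A : MPMat n} {i j : Fin n} {p q : ℕ} {x : ℝ} (h : Wk A i j (p + q) x) :
    ∃ k x1 x2, Wk A i k p x1 ∧ Wk A k j q x2 ∧ x = x1 + x2 := by
  obtain ⟨w, y, h1, h2, h3, h4, h5⟩ := h.fn
  refine ⟨w p, y p, x - y p, ?_, ?_, by ring⟩
  · have := h1.seg (Nat.zero_le p) (by omega)
    rw [h2] at this
    exact this.cast (by simp) (by simp [h3])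
  · have := h1.seg (show p ≤ p + q by omega) le_rfl
    rw [h4, h5] at this
    exact this.cast (by omega) rfl

/-! mpPow -/

theorem mpMul_attain {n : ℕ} (A B : MPMat n) (i j : Fin n) :
    ∃ k, mpMul A B i j = A i k + B k j := by
  obtain ⟨k, _, hk⟩ := Finset.exists_mem_eq_sup (Finset.univ : Finset (Fin n)) ⟨i, Finset.mem_univ i⟩
    (fun k => A i k + B k j)
  exact ⟨k, hk⟩

theorem le_mpMul {n : ℕ} (A B : MPMat n) (i j k : Fin n) :
    A i k + B k j ≤ mpMul A B i j :=
  Finset.le_sup (f := fun k => A i k + B k j) (Finset.mem_univ k)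

theorem Wk.le_pow {n : ℕ} {A : MPMat n} {i j : Fin n} {t : ℕ} {x : ℝ} (h : Wk A i j t x) :
    (x : WithBot ℝ) ≤ mpPow A t i j := by
  induction h with
  | nil i => simp [mpPow]
  | @cons i j k t x a ha _ ih =>
    refine le_trans ?_ (le_mpMul A (mpPow A t) i k j)
    rw [ha]; push_cast
    exact add_le_add le_rfl ih

theorem wk_of_pow {n : ℕ} {A : MPMat n} {t : ℕ} : ∀ {i j : Fin n} {x : ℝ}, 
    mpPow A t i j = (x : WithBot ℝ) → Wk A i j t x := by
  induction t with
  | zero =>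
    intro i j x h
    simp only [mpPow] at h
    split_ifs at h with hij
    · subst hij
      have : (0 : ℝ) = x := by exact_mod_cast h
      exact (Wk.nil i).cast rfl this
    · exact absurd h.symm (WithBot.coe_ne_bot)
  | succ t ih =>
    intro i j x h
    obtain ⟨k, hk⟩ := mpMul_attain A (mpPow A t) i j
    simp only [mpPow] at h
    rw [hk] at h
    rcases ha : A i k with _ | a
    · rw [ha] at h; exact absurd h.symm (by simp [WithBot.none_eq_bot])
    rcases hb : mpPow A t k j with _ | b
    · rw [hb] at h; exact absurd h.symm (by simp [WithBot.none_eq_bot])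
    rw [ha, hb] at h
    have : a + b = x := by
      change ((a : WithBot ℝ) + (b : WithBot ℝ)) = x at h
      exact_mod_cast h
    exact ((ih hb).cons a ha).cast rfl this

theorem pow_le {n : ℕ} {A : MPMat n} {t : ℕ} {i j : Fin n} {z : WithBot ℝ}
    (h : ∀ x, Wk A i j t x → (x : WithBot ℝ) ≤ z) : mpPow A t i j ≤ z := by
  rcases hx : mpPow A t i j with _ | x
  · exact bot_le
  · exact h x (wk_of_pow hx)

theorem wk_powpow {n : ℕ} {A : MPMat n} {g : ℕ} {i j : Fin n} {m : ℕ} {x : ℝ}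
    (h : Wk (mpPow A g) i j m x) : Wk A i j (m * g) x := by
  induction h with
  | nil i => exact (Wk.nil i).cast (by simp) rfl
  | cons a ha _ ih => exact ((wk_of_pow ha).trans ih).cast (by ring) rfl

theorem Wk.le_powpow {n : ℕ} {A : MPMat n} {g : ℕ} {j : Fin n} {m : ℕ} : ∀ {i : Fin n} {x : ℝ},
    Wk A i j (m * g) x → (x : WithBot ℝ) ≤ mpPow (mpPow A g) m i j := by
  induction m with
  | zero =>
    intro i x h
    have h : Wk A i j 0 x := h.cast (by simp) rfl
    exact h.le_pow
  | succ m ih =>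
    intro i x h
    have h : Wk A i j (g + m * g) x := h.cast (by ring) rfl
    obtain ⟨k, x1, x2, h1, h2, rfl⟩ := h.split
    refine le_trans ?_ (le_mpMul _ _ i j k)
    push_cast
    exact add_le_add h1.le_pow (ih h2)

theorem walkWeight_cons {n : ℕ} (A : MPMat n) (a b : Fin n) (l : List (Fin n)) :
    walkWeight A (a :: b :: l) = A a b + walkWeight A (b :: l) := by
  simp [walkWeight]

theorem list_fn {n : ℕ} (A : MPMat n) (d : Fin n) : ∀ W : List (Fin n), W ≠ [] →
    W.IsChain (fun i j => A i j ≠ ⊥) → ∃ y : ℕ → ℝ, y 0 = 0 ∧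
      Fw A (W.length - 1) (fun k => W.getD k d) y ∧ walkWeight A W = (y (W.length - 1) : WithBot ℝ)
  | [], h, _ => absurd rfl h
  | [a], _, _ => ⟨fun _ => 0, rfl, by intro k hk; simp at hk, by simp [walkWeight]⟩
  | a :: b :: l, _, h => by
    rw [List.isChain_cons_cons] at h
    obtain ⟨y, h0, hF, hw⟩ := list_fn A d (b :: l) (by simp) h.2
    obtain ⟨r, hr⟩ := WithBot.ne_bot_iff_exists.1 h.1
    refine ⟨fun k => Nat.casesOn k 0 (fun k => r + y k), rfl, ?_, ?_⟩
    · intro k hk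
      cases k with
      | zero => simp [h0, hr]
      | succ k =>
        have := hF k (by simp at hk ⊢; omega)
        simp only [List.getD_cons_succ] at this ⊢
        rw [this]; congr 1; ring
    · rw [walkWeight_cons, hw, ← hr]
      simp

theorem fn_list {n : ℕ} {A : MPMat n} {w : ℕ → Fin n} {y : ℕ → ℝ} : ∀ (c s : ℕ),
    Fw A (s + c) w y → ((List.range' s (c + 1)).map w).IsChain (fun i j => A i j ≠ ⊥) ∧
      walkWeight A ((List.range' s (c + 1)).map w) = ((y (s + c) - y s : ℝ) : WithBot ℝ) ∧
      ∀ k < c, (w (s + k), w (s + k + 1)) ∈ ((List.range' s (c + 1)).map w).zip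
        ((List.range' s (c + 1)).map w).tail
  | 0, s, _ => by simp [walkWeight]
  | c + 1, s, h => by
    obtain ⟨h1, h2, h3⟩ := fn_list c (s + 1) (by convert h using 1; ring)
    rw [List.range'_succ, List.map_cons]
    rw [List.range'_succ, List.map_cons] at h1 h2 h3 ⊢
    have hs := h s (by omega)
    refine ⟨?_, ?_, ?_⟩
    · rw [List.isChain_cons_cons]
      exact ⟨by rw [hs]; exact WithBot.coe_ne_bot, h1⟩
    · rw [walkWeight_cons, h2, hs, ← WithBot.coe_add]
      congr 1
      rw [show s + 1 + c = s + (c + 1) by ring]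
      ring
    · intro k hk
      cases k with
      | zero => simp
      | succ k =>
        have := h3 k (by omega)
        rw [show s + 1 + k = s + (k + 1) by ring] at this
        exact List.mem_cons_of_mem _ this

/-- functional cycle -/
def Cyc {n : ℕ} (A : MPMat n) (c : ℕ) (w : ℕ → Fin n) (y : ℕ → ℝ) : Prop :=
  1 ≤ c ∧ Fw A c w y ∧ w c = w 0 ∧ Set.InjOn w (Set.Iio c) ∧ y 0 = 0

theorem cyc_of_list {n : ℕ} {A : MPMat n} {W : List (Fin n)} (h : IsCycleIn (digr A) W) :
    ∃ c w y, Cyc A c w y ∧ W.length = c + 1 ∧ walkWeight A W = (y c : WithBot ℝ) ∧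
      (∀ u ∈ W, ∃ k < c, w k = u) ∧ (∀ k ≤ c, w k ∈ W) ∧
      (∀ u v, (u, v) ∈ W.zip W.tail → ∃ k < c, w k = u ∧ w (k + 1) = v) := by
  obtain ⟨⟨hne, _, hch⟩, hlen, hhl, hnd⟩ := h
  have d : Fin n := W.head hne
  obtain ⟨y, h0, hF, hw⟩ := list_fn A d W hne hch
  have hD : ∀ k (hk : k < W.length), W.getD k d = W[k] := by
    intro k hk; simp [hk]
  have hc0 : W.getD (W.length - 1) d = W.getD 0 d := by
    rw [hD _ (by omega), hD _ (by omega)]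
    have h1 : W.head? = some W[0] := by rw [List.head?_eq_getElem?]; simp
    have h2 : W.getLast? = some W[W.length - 1] := by rw [List.getLast?_eq_getElem?]; simp
    rw [h1, h2] at hhl
    simpa using hhl.symm
  refine ⟨W.length - 1, fun k => W.getD k d, y, ⟨by omega, hF, hc0, ?_, h0⟩, by omega, hw,
    ?_, ?_, ?_⟩
  · intro a ha b hb hab
    simp only [Set.mem_Iio] at ha hb
    have hab : W.getD a d = W.getD b d := hab
    rw [hD a (by omega), hD b (by omega)] at hab
    have := (hnd.getElem_inj_iff (i := a) (j := b) (hi := by simpa using ha)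
      (hj := by simpa using hb)).1 (by simpa using hab)
    exact this
  · intro u hu
    obtain ⟨k, hk, rfl⟩ := List.getElem_of_mem hu
    by_cases hkc : k < W.length - 1
    · exact ⟨k, hkc, hD k hk⟩
    · have : k = W.length - 1 := by omega
      subst this
      refine ⟨0, by omega, ?_⟩
      change W.getD 0 d = _
      rw [← hc0, hD _ hk]
  · intro k hk
    change W.getD k d ∈ W
    rw [hD k (by omega)]
    exact List.getElem_mem _
  · intro u v huv
    obtain ⟨k, hk, hkk⟩ := List.getElem_of_mem huv
    simp only [List.length_zip, List.length_tail] at hk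
    simp only [List.getElem_zip, List.getElem_tail, Prod.mk.injEq] at hkk
    refine ⟨k, by omega, ?_, ?_⟩
    · change W.getD k d = u
      rw [hD k (by omega)]; exact hkk.1
    · change W.getD (k+1) d = v
      rw [hD (k+1) (by omega)]; exact hkk.2

theorem list_of_cyc {n : ℕ} {A : MPMat n} {c : ℕ} {w : ℕ → Fin n} {y : ℕ → ℝ} (h : Cyc A c w y) :
    ∃ W, IsCycleIn (digr A) W ∧ W.length = c + 1 ∧ walkWeight A W = (y c : WithBot ℝ) ∧
      (∀ k ≤ c, w k ∈ W) ∧ (∀ u ∈ W, ∃ k ≤ c, w k = u) ∧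
      (∀ k < c, (w k, w (k + 1)) ∈ W.zip W.tail) := by
  obtain ⟨hc, hF, hc0, hinj, h0⟩ := h
  obtain ⟨h1, h2, h3⟩ := fn_list c 0 (by simpa using hF)
  refine ⟨(List.range' 0 (c + 1)).map w, ⟨⟨by simp, by simp [digr], h1⟩, by simpa using hc, ?_, ?_⟩,
    by simp, by rw [h2]; simp [h0], ?_, ?_, by simpa using h3⟩
  · rw [List.head?_eq_getElem?, List.getLast?_eq_getElem?]
    simp [hc0]
  · rw [List.range'_1_concat, List.map_append]
    simp only [List.map_cons, List.map_nil, List.dropLast_concat]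
    refine List.Nodup.map_on ?_ List.nodup_range'
    intro a ha b hb hab
    simp at ha hb
    exact hinj ha hb hab
  · intro k hk
    simp only [List.mem_map, List.mem_range'_1]
    exact ⟨k, by omega, rfl⟩
  · intro u hu
    simp only [List.mem_map, List.mem_range'_1] at hu
    obtain ⟨k, hk, rfl⟩ := hu
    exact ⟨k, by omega, rfl⟩

theorem Cyc.le_card {n : ℕ} {A : MPMat n} {c : ℕ} {w : ℕ → Fin n} {y : ℕ → ℝ} (h : Cyc A c w y) :
    c ≤ n := by
  have := Finset.card_le_card_of_injOn (s := Finset.range c) (t := (Finset.univ : Finset (Fin n))) w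
    (by simp) (by intro a ha b hb; exact h.2.2.2.1 (by simpa using ha) (by simpa using hb))
  simpa using this

theorem Cyc.le_circ {n : ℕ} {A : MPMat n} {c : ℕ} {w : ℕ → Fin n} {y : ℕ → ℝ} (h : Cyc A c w y) :
    c ≤ circumf (digr A) := by
  obtain ⟨W, hW, hl, _⟩ := list_of_cyc h
  refine le_csSup ⟨n, ?_⟩ ⟨W, hW, hl⟩
  rintro l ⟨W, hW, hl⟩
  obtain ⟨c, w, y, hc, hlc, _⟩ := cyc_of_list hW
  have := hc.le_card
  omega

theorem path_le_cab {n : ℕ} {A M : MPMat n} (hs : ∀ i j, M i j ≠ ⊥ → A i j ≠ ⊥) {s c : ℕ}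
    {w : ℕ → Fin n} {y : ℕ → ℝ} (h : Fw M (s + c) w y) (hi : Set.InjOn w (Set.Icc s (s + c))) :
    c ≤ cabDiam (digr A) := by
  obtain ⟨h1, -⟩ := fn_list c s h
  refine le_csSup ⟨n, ?_⟩ ⟨(List.range' s (c + 1)).map w, ⟨⟨by simp, by simp [digr],
    List.IsChain.imp hs h1⟩, ?_⟩, by simp⟩
  · rintro l ⟨W, hW, hl⟩
    have := hW.2.length_le_card
    simp at this; omega
  · refine List.Nodup.map_on ?_ List.nodup_range'
    intro a ha b hb hab
    simp only [List.mem_range'_1] at ha hb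
    exact hi ⟨ha.1, by omega⟩ ⟨hb.1, by omega⟩ hab

/-- closed walks are bounded if cycles are. -/
theorem closed_le {n : ℕ} {A : MPMat n} {m : ℝ}
    (hA : ∀ c w y, Cyc A c w y → y c ≤ c * m) : ∀ (c : ℕ) (i : Fin n) (x : ℝ),
    Wk A i i c x → x ≤ c * m := by
  intro c
  induction c using Nat.strong_induction_on with
  | _ c ih =>
    intro i x h
    obtain ⟨w, y, hF, hw0, hy0, hwt, hyt⟩ := h.fn
    rcases Nat.eq_zero_or_pos c with hc | hc
    · subst hc; simp [← hyt, hy0]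
    by_cases hinj : Set.InjOn w (Set.Iio c)
    · rw [← hyt]; exact hA c w y ⟨hc, hF, by rw [hwt, hw0], hinj, hy0⟩
    · have : ∃ s e, s < e ∧ e < c ∧ w s = w e := by
        simp only [Set.InjOn, Set.mem_Iio] at hinj
        push Not at hinj
        obtain ⟨a, ha, b, hb, hab, hne⟩ := hinj
        rcases lt_or_gt_of_ne hne with h | h
        · exact ⟨a, b, h, hb, hab⟩
        · exact ⟨b, a, h, ha, hab.symm⟩
      obtain ⟨s, e, hse, hec, hwe⟩ := this
      have s1 := hF.seg (Nat.zero_le s) (by omega)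
      have s2 := hF.seg hse.le (by omega)
      have s3 := hF.seg hec.le le_rfl
      rw [hwe] at s2
      rw [hw0, hwe] at s1
      rw [hwt] at s3
      have i1 := ih _ (by omega) _ _ s2
      have i2 := ih _ (by omega) _ _ (s1.trans s3)
      rw [Nat.cast_sub hse.le] at i1
      push_cast [Nat.cast_sub hec.le] at i2
      rw [hyt, hy0] at i2
      simp at i2
      linarith

theorem exists_cyc_of_closed {n : ℕ} {A : MPMat n} : ∀ (c : ℕ) (i : Fin n) (x : ℝ),
    0 < c → Wk A i i c x → ∃ c w y, Cyc A c w y ∧ w 0 = i := by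
  intro c
  induction c using Nat.strong_induction_on with
  | _ c ih =>
    intro i x hc h
    obtain ⟨w, y, hF, hw0, hy0, hwt, hyt⟩ := h.fn
    by_cases hinj : Set.InjOn w (Set.Iio c)
    · exact ⟨c, w, y, ⟨hc, hF, by rw [hwt, hw0], hinj, hy0⟩, hw0⟩
    · have : ∃ s e, s < e ∧ e < c ∧ w s = w e := by
        simp only [Set.InjOn, Set.mem_Iio] at hinj
        push Not at hinj
        obtain ⟨a, ha, b, hb, hab, hne⟩ := hinj
        rcases lt_or_gt_of_ne hne with h | h
        · exact ⟨a, b, h, hb, hab⟩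
        · exact ⟨b, a, h, ha, hab.symm⟩
      obtain ⟨s, e, hse, hec, hwe⟩ := this
      have s1 := hF.seg (Nat.zero_le s) (by omega)
      have s3 := hF.seg hec.le le_rfl
      rw [hw0, hwe] at s1
      rw [hwt] at s3
      exact ih _ (by omega) _ _ (by omega) (s1.trans s3)

/-- reduced walks of the prefix `[0,t]`, of length `r`. -/
def Nn {n : ℕ} (M : MPMat n) (w : ℕ → Fin n) (y : ℕ → ℝ) (a t r : ℕ) : Prop :=
  r ≤ t ∧ ((t ≤ a ∧ ∃ x, y t - y 0 ≤ x ∧ Wk M (w 0) (w t) r x) ∨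
    (a ≤ t ∧ ∃ p q x1 x2, Wk M (w 0) (w a) p x1 ∧ Wk M (w a) (w t) q x2 ∧ p + q = r ∧
      y t - y 0 ≤ x1 + x2))

theorem Nn.step {n : ℕ} {M : MPMat n} {w : ℕ → Fin n} {y : ℕ → ℝ} {a t r L : ℕ} (hF : Fw M L w y)
    (h : Nn M w y a t r) (ht : t + 1 ≤ L) : Nn M w y a (t + 1) (r + 1) := by
  obtain ⟨hr, h⟩ := h
  refine ⟨by omega, ?_⟩
  have e := Wk.single (hF t (by omega))
  have key2 : ∀ p q x1 x2, Wk M (w 0) (w a) p x1 → Wk M (w a) (w t) q x2 → p + q = r → 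
      y t - y 0 ≤ x1 + x2 → ∃ p q x1 x2, Wk M (w 0) (w a) p x1 ∧ Wk M (w a) (w (t+1)) q x2 ∧
        p + q = r + 1 ∧ y (t+1) - y 0 ≤ x1 + x2 := by
    intro p q x1 x2 h1 h2 h3 h4
    exact ⟨p, q + 1, x1, _, h1, h2.trans e, by omega, by linarith⟩
  rcases h with ⟨hta, x, hx, hW⟩ | ⟨hta, p, q, x1, x2, h1, h2, h3, h4⟩
  · rcases Nat.lt_or_ge t a with hlt | hge
    · exact Or.inl ⟨by omega, _, by linarith, hW.trans e⟩
    · have : t = a := by omega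
      subst this
      exact Or.inr ⟨by omega, key2 r 0 x 0 hW (Wk.nil _) (by simp) (by linarith)⟩
  · exact Or.inr ⟨by omega, key2 p q x1 x2 h1 h2 h3 h4⟩

theorem Nn.carry {n : ℕ} {M : MPMat n} {w : ℕ → Fin n} {y : ℕ → ℝ} {a t r L : ℕ} (hF : Fw M L w y)
    (h : Nn M w y a t r) (d : ℕ) (ht : t + d ≤ L) : Nn M w y a (t + d) (r + d) := by
  induction d with
  | zero => exact h
  | succ d ih => exact (ih (by omega)).step hF (by omega)

theorem Nn.skip {n : ℕ} {M : MPMat n} {w : ℕ → Fin n} {y : ℕ → ℝ} {a s t r L : ℕ} (hF : Fw M L w y)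
    (hM : ∀ c i x, Wk M i i c x → x ≤ 0)
    (h : Nn M w y a s r) (hst : s < t) (ht : t ≤ L) (hw : w s = w t) (had : t ≤ a ∨ a ≤ s) :
    Nn M w y a t r := by
  have e := hF.seg hst.le ht
  rw [hw] at e
  have e := hM _ _ _ e
  obtain ⟨hr, h⟩ := h
  refine ⟨by omega, ?_⟩
  rcases h with ⟨hta, x, hx, hW⟩ | ⟨hta, p, q, x1, x2, h1, h2, h3, h4⟩
  · rcases had with had | had
    · exact Or.inl ⟨had, x, by linarith, hw ▸ hW⟩
    · have : s = a := by omega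
      subst this
      refine Or.inr ⟨by omega, r, 0, x, 0, hW, ?_, by simp, by linarith⟩
      rw [hw]; exact Wk.nil _
  · have : a ≤ s := hta
    exact Or.inr ⟨by omega, p, q, x1, x2, h1, hw ▸ h2, h3, by linarith⟩

theorem key {n : ℕ} {M : MPMat n} (hM : ∀ c i x, Wk M i i c x → x ≤ 0) {L : ℕ} {w : ℕ → Fin n}
    {y : ℕ → ℝ} (hF : Fw M L w y) (Z : Finset (Fin n)) (a : ℕ) (ha : a ≤ L) (hZ : w a ∈ Z) (D : ℕ)
    (hD : ∀ s c, s + c ≤ L → Set.InjOn w (Set.Icc s (s + c)) → c ≤ D)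
    (hT : n * Z.card + n ≤ L + Z.card ∨ (Z.card = 1 ∧ 2 * D + 1 ≤ L) ∨ (Z.card + 1) * (D + 1) ≤ L) :
    ∃ p q x1 x2 v, v ∈ Z ∧ Wk M (w 0) v p x1 ∧ Wk M v (w L) q x2 ∧ p + q < L ∧
      p + q ≡ L [MOD Z.card] ∧ y L - y 0 ≤ x1 + x2 := by
  by_contra hcon
  have hl : 0 < Z.card := Finset.card_pos.2 ⟨_, hZ⟩
  have : NeZero Z.card := ⟨hl.ne'⟩
  have irr : ∀ t ≤ L, ∀ r < t, Nn M w y a t r → (r : ZMod Z.card) ≠ t := by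
    intro t ht r hr hN hrt
    have h := hN.carry hF (L - t) (by omega)
    rw [show t + (L - t) = L by omega] at h
    have hmod : r + (L - t) ≡ L [MOD Z.card] := by
      rw [← ZMod.natCast_eq_natCast_iff]
      push_cast [Nat.cast_sub ht]
      rw [hrt]; ring
    obtain ⟨hr, h⟩ := h
    rcases h with ⟨hta, x, hx, hW⟩ | ⟨hta, p, q, x1, x2, h1, h2, h3, h4⟩
    · have : L = a := by omega
      exact hcon ⟨r + (L - t), 0, x, 0, w a, hZ, this ▸ hW, this ▸ Wk.nil _, by omega, by simpa using hmod,
        by linarith⟩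
    · exact hcon ⟨p, q, x1, x2, w a, hZ, h1, h2, by omega, by rw [h3]; exact hmod, h4⟩
  have N0 : ∀ t ≤ L, Nn M w y a t t := by
    intro t ht
    have : Nn M w y a 0 0 := ⟨le_rfl, Or.inl ⟨by omega, 0, by simp, Wk.nil _⟩⟩
    simpa using this.carry hF t (by omega)
  let Λ : ℕ → Finset (ZMod Z.card) := fun t =>
    Finset.univ.filter (fun z => ∃ r, Nn M w y a t r ∧ (r : ZMod Z.card) = z)
  have hΛ : ∀ t z, z ∈ Λ t ↔ ∃ r, Nn M w y a t r ∧ (r : ZMod Z.card) = z := by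
    intro t z; simp [Λ]
  have himg : ∀ s t, s ≤ t → t ≤ L → (Λ s).image (· + ((t - s : ℕ) : ZMod Z.card)) ⊆ Λ t := by
    intro s t hst ht z hz
    obtain ⟨z', hz', rfl⟩ := Finset.mem_image.1 hz
    obtain ⟨r, hr, rfl⟩ := (hΛ _ _).1 hz'
    refine (hΛ _ _).2 ⟨r + (t - s), ?_, by push_cast; rfl⟩
    have := hr.carry hF (t - s) (by omega)
    rwa [show s + (t - s) = t by omega] at this
  have hcimg : ∀ s t, ((Λ s).image (· + ((t - s : ℕ) : ZMod Z.card))).card = (Λ s).card := by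
    intro s t
    exact Finset.card_image_of_injective _ (add_left_injective _)
  have hmono : ∀ s t, s ≤ t → t ≤ L → (Λ s).card ≤ (Λ t).card := by
    intro s t hst ht
    rw [← hcimg s t]
    exact Finset.card_le_card (himg s t hst ht)
  have hstrict : ∀ s t, s < t → t ≤ L → w s = w t → (t ≤ a ∨ a ≤ s) → (Λ s).card < (Λ t).card := by
    intro s t hst ht hw had
    by_contra hle
    have hsub : Λ s ⊆ Λ t := by
      intro z hz
      obtain ⟨r, hr, rfl⟩ := (hΛ _ _).1 hz
      exact (hΛ _ _).2 ⟨r, hr.skip hF hM hst ht hw had, rfl⟩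
    have heq := Finset.eq_of_subset_of_card_le hsub (not_lt.1 hle)
    have htm : (t : ZMod Z.card) ∈ Λ s := by
      rw [heq]; exact (hΛ _ _).2 ⟨t, N0 t ht, rfl⟩
    obtain ⟨r, hr, hrt⟩ := (hΛ _ _).1 htm
    exact irr t ht r (lt_of_le_of_lt hr.1 hst) (hr.skip hF hM hst ht hw had) hrt
  let φ : ℕ → ℕ := fun t => (Λ t).card + if t ≤ a then 0 else 1
  have hφm : ∀ s t, s ≤ t → t ≤ L → φ s ≤ φ t := by
    intro s t hst ht
    have := hmono s t hst ht
    simp only [φ]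
    split_ifs <;> omega
  have hφi : ∀ s t, s < t → t ≤ L → w s = w t → φ s ≠ φ t := by
    intro s t hst ht hw heq
    have h1 := hmono s t hst.le ht
    have h2 := hstrict s t hst ht hw
    simp only [φ] at heq
    split_ifs at heq <;> omega
  have hφ1 : ∀ t ≤ L, φ t ∈ Finset.Icc 1 (Z.card + 1) := by
    intro t ht
    have h1 : 1 ≤ (Λ t).card := Finset.card_pos.2 ⟨_, (hΛ _ _).2 ⟨t, N0 t ht, rfl⟩⟩
    have h2 : (Λ t).card ≤ Z.card := by
      have := Finset.card_le_univ (Λ t)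
      rwa [ZMod.card] at this
    simp only [φ, Finset.mem_Icc]
    split_ifs <;> omega
  rcases hT with hT | ⟨h1, hT⟩ | hT
  · have hz : ∀ z ∈ Z, ((Finset.range (L+1)).filter (fun t => w t = z)).card ≤ Z.card := by
      intro z hz
      have := Finset.card_le_card_of_injOn (s := (Finset.range (L+1)).filter (fun t => w t = z))
        (t := (Finset.univ : Finset (ZMod Z.card))) (fun t => (t : ZMod Z.card)) (by simp) ?_
      · simpa [ZMod.card] using this
      · have main : ∀ s t, s < t → t ≤ L → w s = z → w t = z → (s : ZMod Z.card) ≠ t := by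
          intro s t hst ht hs hte hh
          have e1 := hF.seg (Nat.zero_le s) (by omega)
          have e2 := hF.seg hst.le ht
          have e3 := hF.seg ht le_rfl
          rw [hte] at e3 e2
          rw [hs] at e1 e2
          refine hcon ⟨_, _, _, _, z, hz, e1, e3, by omega, ?_, by linarith [hM _ _ _ e2]⟩
          rw [← ZMod.natCast_eq_natCast_iff]
          push_cast [Nat.cast_sub ht]
          rw [Nat.sub_zero, hh]; simp
        intro s hs t ht hst
        simp at hs ht hst
        rcases lt_trichotomy s t with h | h | h
        · exact absurd hst (main s t h (by omega) hs.2 ht.2)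
        · exact h
        · exact absurd hst.symm (main t s h (by omega) ht.2 hs.2)
    have hx : ∀ x, ((Finset.range (L+1)).filter (fun t => w t = x)).card ≤ Z.card + 1 := by
      intro x
      have := Finset.card_le_card_of_injOn (s := (Finset.range (L+1)).filter (fun t => w t = x))
        (t := Finset.Icc 1 (Z.card + 1)) φ ?_ ?_
      · simpa using this
      · intro t ht
        simp at ht
        exact hφ1 t (by omega)
      · intro s hs t ht hst
        simp at hs ht
        rcases lt_trichotomy s t with h | h | h
        · exact absurd hst (hφi s t h (by omega) (by rw [hs.2, ht.2]))
        · exact h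
        · exact absurd hst.symm (hφi t s h (by omega) (by rw [hs.2, ht.2]))
    have hsum := Finset.card_eq_sum_card_fiberwise (s := Finset.range (L+1))
      (t := (Finset.univ : Finset (Fin n))) (f := w) (by simp)
    rw [Finset.card_range, ← Finset.sum_add_sum_compl Z] at hsum
    have b1 := Finset.sum_le_card_nsmul Z _ _ hz
    have b2 := Finset.sum_le_card_nsmul Zᶜ (fun x => ((Finset.range (L+1)).filter (fun t => w t = x)).card) _ (fun x _ => hx x)
    have hc : Z.card + (Zᶜ).card = n := by simp
    simp only [smul_eq_mul] at b1 b2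
    have : n * Z.card + n = Z.card * Z.card + Zᶜ.card * (Z.card + 1) + Z.card := by
      have hm := congrArg (fun k => k * (Z.card + 1)) hc
      linarith
    omega
  · have inj : ∀ s e, s ≤ e → e ≤ L → (e ≤ a ∨ a ≤ s) → e - s ≤ D := by
      intro s e hse he had
      apply hD s (e - s) (by omega)
      have main : ∀ p q, s ≤ p → p < q → q ≤ e → w p ≠ w q := by
        intro p q hp hpq hq hw
        have := hstrict p q hpq (by omega) hw (by omega)
        have h2 : (Λ q).card ≤ Z.card := by
          have := Finset.card_le_univ (Λ q)
          rwa [ZMod.card] at this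
        have h1 : 1 ≤ (Λ p).card := Finset.card_pos.2 ⟨_, (hΛ _ _).2 ⟨p, N0 p (by omega), rfl⟩⟩
        omega
      intro p hp q hq hpq
      simp only [Set.mem_Icc] at hp hq
      rcases lt_trichotomy p q with h | h | h
      · exact absurd hpq (main p q (by omega) h (by omega))
      · exact h
      · exact absurd hpq.symm (main q p (by omega) h (by omega))
    have := inj 0 a (by omega) ha (by omega)
    have := inj a L ha le_rfl (by omega)
    omega
  · have hsum := Finset.card_eq_sum_card_fiberwise (s := Finset.range (L+1))
      (t := Finset.Icc 1 (Z.card + 1)) (f := φ) 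
      (by intro t ht; simp at ht; exact hφ1 t (by omega))
    have hfib : ∀ c ∈ Finset.Icc 1 (Z.card + 1),
        ((Finset.range (L+1)).filter (fun t => φ t = c)).card ≤ D + 1 := by
      intro c _
      set F := (Finset.range (L+1)).filter (fun t => φ t = c) with hFdef
      rcases F.eq_empty_or_nonempty with he | hne
      · simp [he]
      · have hmin := F.min'_mem hne
        have hmax := F.max'_mem hne
        set s := F.min' hne
        set e := F.max' hne
        have hse : s ≤ e := F.min'_le _ hmax
        simp only [hFdef, Finset.mem_filter, Finset.mem_range] at hmin hmax
        have hd : e - s ≤ D := by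
          apply hD s (e - s) (by omega)
          have main : ∀ p q, s ≤ p → p < q → q ≤ e → w p ≠ w q := by
            intro p q hp hpq hq hw
            have h1 := hφi p q hpq (by omega) hw
            have h2 := hφm s p hp (by omega)
            have h3 := hφm p q hpq.le (by omega)
            have h4 := hφm q e hq (by omega)
            omega
          intro p hp q hq hpq
          simp only [Set.mem_Icc] at hp hq
          rcases lt_trichotomy p q with h | h | h
          · exact absurd hpq (main p q (by omega) h (by omega))
          · exact h
          · exact absurd hpq.symm (main q p (by omega) h (by omega))
        have hsub : F ⊆ Finset.Icc s e := fun t ht =>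
          Finset.mem_Icc.2 ⟨F.min'_le _ ht, F.le_max' _ ht⟩
        have := Finset.card_le_card hsub
        simp at this
        omega
    have := Finset.sum_le_card_nsmul _ _ _ hfib
    simp only [smul_eq_mul, Nat.card_Icc] at this
    rw [Finset.card_range] at hsum
    have e : (Z.card + 1 + 1 - 1) = Z.card + 1 := by omega
    rw [e] at this
    omega

/-- the length bound hypothesis -/
def LenOK (n c ch D : ℕ) : Prop := ∀ l, 1 ≤ l → l ≤ ch → 
  (n * l + n ≤ c + l ∨ (l = 1 ∧ 2 * D + 1 ≤ c) ∨ (l + 1) * (D + 1) ≤ c)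

theorem lenOK2 {n ch D t : ℕ} (h : ((D : ℤ) + ch - 1) * ch + D + 1 ≤ t) : LenOK n t ch D := by
  intro l h1 h2
  rcases Nat.lt_or_ge ch 2 with hc | hc
  · have h3 : ch = 1 := by omega
    subst h3
    refine Or.inr (Or.inl ⟨by omega, ?_⟩)
    push_cast at h
    zify; linarith
  · refine Or.inr (Or.inr ?_)
    zify at *
    nlinarith

theorem lenOK1 {n ch D t : ℕ} (hch : 1 ≤ ch) (h : ((n : ℤ) - 1) * ch + min (n : ℤ) ((D : ℤ) + ch + 1) ≤ t) :
    LenOK n t ch D := by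
  rcases le_or_gt (n : ℤ) ((D : ℤ) + ch + 1) with hc | hc
  · rw [min_eq_left hc] at h
    intro l h1 h2
    left
    zify at *
    nlinarith
  · rw [min_eq_right hc.le] at h
    apply lenOK2
    zify at *
    nlinarith

theorem Fw.le {n : ℕ} {A : MPMat n} {t s : ℕ} {w : ℕ → Fin n} {y : ℕ → ℝ} (h : Fw A t w y)
    (hs : s ≤ t) : Fw A s w y := fun k hk => h k (by omega)

theorem key' {n : ℕ} {A M : MPMat n} (hs : ∀ i j, M i j ≠ ⊥ → A i j ≠ ⊥)
    (hM : ∀ c i x, Wk M i i c x → x ≤ 0) {L : ℕ} {w : ℕ → Fin n}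
    {y : ℕ → ℝ} (hF : Fw M L w y) {c : ℕ} {wz : ℕ → Fin n} {yz : ℕ → ℝ} (hZ : Cyc A c wz yz)
    (a k : ℕ) (ha : a ≤ L) (hk : k < c) (hak : w a = wz k)
    (hT : LenOK n L (circumf (digr A)) (cabDiam (digr A))) :
    ∃ p q x1 x2 k, k < c ∧ Wk M (w 0) (wz k) p x1 ∧ Wk M (wz k) (w L) q x2 ∧ p + q < L ∧
      p + q ≡ L [MOD c] ∧ y L - y 0 ≤ x1 + x2 := by
  have hcard : ((Finset.range c).image wz).card = c := by
    rw [Finset.card_image_of_injOn, Finset.card_range]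
    intro p hp q hq
    exact hZ.2.2.2.1 (by simpa using hp) (by simpa using hq)
  obtain ⟨p, q, x1, x2, v, hv, h1, h2, h3, h4, h5⟩ := key hM hF ((Finset.range c).image wz) a ha
    (Finset.mem_image.2 ⟨k, by simpa using hk, hak.symm⟩) (cabDiam (digr A))
    (fun s d hsd hi => path_le_cab hs (hF.le hsd) hi) (by rw [hcard]; exact hT c hZ.1 hZ.le_circ)
  obtain ⟨k', hk', rfl⟩ := Finset.mem_image.1 hv
  rw [hcard] at h4
  exact ⟨p, q, x1, x2, k', by simpa using hk', h1, h2, h3, h4, h5⟩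

theorem Cyc.between {n : ℕ} {A : MPMat n} {c : ℕ} {w : ℕ → Fin n} {y : ℕ → ℝ} (h : Cyc A c w y)
    {k k' : ℕ} (hk : k < c) (hk' : k' < c) : ∃ p q x1 x2, Wk A (w k) (w k') p x1 ∧
      Wk A (w k') (w k) q x2 ∧ p + q = c ∧ x1 + x2 = y c := by
  have main : ∀ k k', k < c → k' < c → k ≤ k' → ∃ p q x1 x2, Wk A (w k) (w k') p x1 ∧
      Wk A (w k') (w k) q x2 ∧ p + q = c ∧ x1 + x2 = y c := by
    intro k k' hk hk' hkk
    have s1 := h.2.1.seg hkk hk'.le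
    have s2 := h.2.1.seg hk'.le le_rfl
    have s3 := h.2.1.seg (Nat.zero_le k) hk.le
    rw [h.2.2.1] at s2
    exact ⟨_, _, _, _, s1, s2.trans s3, by omega, by rw [h.2.2.2.2]; ring⟩
  rcases le_total k k' with hh | hh
  · exact main k k' hk hk' hh
  · obtain ⟨p, q, x1, x2, h1, h2, h3, h4⟩ := main k' k hk' hk hh
    exact ⟨q, p, x2, x1, h2, h1, by omega, by linarith⟩

theorem Cyc.around {n : ℕ} {A : MPMat n} {c : ℕ} {w : ℕ → Fin n} {y : ℕ → ℝ} (h : Cyc A c w y)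
    {k : ℕ} (hk : k < c) : Wk A (w k) (w k) c (y c) := by
  obtain ⟨p, q, x1, x2, h1, h2, h3, h4⟩ := h.between hk hk
  exact (h1.trans h2).cast h3 h4

/-- part 1: adjust the length of a walk through a zero-mean cycle. -/
theorem adjust {n : ℕ} {A : MPMat n}
    (hM : ∀ c i x, Wk A i i c x → x ≤ 0) {c : ℕ} {wz : ℕ → Fin n} {yz : ℕ → ℝ} (hZ : Cyc A c wz yz)
    (h0 : yz c = 0) {t : ℕ} (hT : LenOK n t (circumf (digr A)) (cabDiam (digr A))) {i j : Fin n} :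
    ∀ (N p q : ℕ) (x1 x2 : ℝ) (k : ℕ), k < c → p + q = N → Wk A i (wz k) p x1 → Wk A (wz k) j q x2 →
      N ≡ t [MOD c] → ∃ x, x1 + x2 ≤ x ∧ Wk A i j t x := by
  intro N
  induction N using Nat.strong_induction_on with
  | _ N ih =>
    intro p q x1 x2 k hk hN h1 h2 hmod
    rcases le_or_gt N t with hNt | hNt
    · obtain ⟨e, he⟩ := (Nat.modEq_iff_dvd' hNt).1 hmod
      have := ((hZ.around hk).nsmul e)
      refine ⟨_, ?_, ((h1.trans this).trans h2).cast (t' := t) ?_ rfl⟩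
      · rw [h0]; linarith
      · have : e * c = t - N := by rw [he]; ring
        omega
    · obtain ⟨w, y, hF, g1, g2, g3, g4, g5⟩ := h1.fn2 h2
      rw [hN] at hF g4 g5
      have hT' : LenOK n N (circumf (digr A)) (cabDiam (digr A)) := by
        intro l hl hl'
        have := hT l hl hl'
        omega
      obtain ⟨p', q', x1', x2', k', hk', f1, f2, f3, f4, f5⟩ := key' (A := A) (fun i j h => h) hM hF hZ p k
        (by omega) hk g3 hT'
      rw [g1] at f1
      rw [g4] at f2
      obtain ⟨x, hx, hx'⟩ := ih _ f3 p' q' x1' x2' k' hk' rfl f1 f2 (f4.trans hmod)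
      exact ⟨x, by linarith, hx'⟩

theorem improve {n : ℕ} {A : MPMat n} {m : ℝ} {t : ℕ}
    (hT : LenOK n t (circumf (digr A)) (cabDiam (digr A)))
    {w : ℕ → Fin n} {y : ℕ → ℝ} (hF : Fw A t w y) (hy0 : y 0 = 0)
    {c : ℕ} {wz : ℕ → Fin n} {yz : ℕ → ℝ} (hZ : Cyc A c wz yz) (hm : yz c = c * m)
    (hmax : ∀ c' w' y', Cyc A c' w' y' → (∃ k ≤ c', ∃ a ≤ t, w' k = w a) → y' c' ≤ c' * m)
    {a k k' : ℕ} (ha : a ≤ t) (hk : k < c) (hak : w a = wz k) (hk' : k' < c) :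
    ∃ w' y', Fw A t w' y' ∧ w' 0 = w 0 ∧ w' t = w t ∧ y' 0 = 0 ∧ y t ≤ y' t ∧
      ∃ a' ≤ t, w' a' = wz k' := by
  let T : Set (Fin n) := {u | ∃ a ≤ t, w a = u}
  let R : MPMat n := fun i j => if i ∈ T ∧ j ∈ T then A i j else ⊥
  have hRA : ∀ i j (a : ℝ), R i j = (a : WithBot ℝ) → A i j = (a : WithBot ℝ) := by
    intro i j a h
    simp only [R] at h
    split_ifs at h
    · exact h
    · exact absurd h.symm WithBot.coe_ne_bot
  have hRT : ∀ i j (a : ℝ), R i j = (a : WithBot ℝ) → i ∈ T := by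
    intro i j a h
    simp only [R] at h
    split_ifs at h with hh
    · exact hh.1
    · exact absurd h.symm WithBot.coe_ne_bot
  have hRc : ∀ c' w' y', Cyc R c' w' y' → y' c' ≤ c' * m := by
    intro c' w' y' hC
    refine hmax c' w' y' ⟨hC.1, fun k hk => hRA _ _ _ (hC.2.1 k hk), hC.2.2⟩ ?_
    obtain ⟨a, ha, haw⟩ := hRT _ _ _ (hC.2.1 0 hC.1)
    exact ⟨0, by omega, a, ha, haw.symm⟩
  have hRF : Fw R t w y := by
    intro k hk
    have : R (w k) (w (k+1)) = A (w k) (w (k+1)) := by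
      simp only [R]
      rw [if_pos ⟨⟨k, by omega, rfl⟩, ⟨k + 1, by omega, rfl⟩⟩]
    rw [this]; exact hF k hk
  have hM : ∀ c i x, Wk (shiftMat R (-m)) i i c x → x ≤ 0 := by
    intro c i x h
    have := closed_le hRc _ _ _ h.unshift
    linarith
  have hMF : Fw (shiftMat R (-m)) t w (fun k => y k - k * m) := by
    intro k hk
    simp only [shiftMat]
    rw [hRF k hk, ← WithBot.coe_add]
    congr 1
    push_cast; ring
  have hs : ∀ i j, shiftMat R (-m) i j ≠ ⊥ → A i j ≠ ⊥ := by
    intro i j h hA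
    apply h
    simp [shiftMat, R, hA]
  obtain ⟨p, q, x1, x2, k'', hk'', f1, f2, f3, f4, f5⟩ := key' hs hM hMF hZ a k ha hk hak hT
  have f1 := f1.unshift.mono hRA
  have f2 := f2.unshift.mono hRA
  obtain ⟨e, he⟩ := (Nat.modEq_iff_dvd' f3.le).1 f4
  obtain ⟨p', q', z1, z2, b1, b2, b3, b4⟩ := hZ.between hk'' hk'
  have he0 : 1 ≤ e := by
    rcases Nat.eq_zero_or_pos e with h | h
    · subst h; omega
    · exact h
  obtain ⟨e, rfl⟩ : ∃ e', e = e' + 1 := ⟨e - 1, by omega⟩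
  have r1 := (f1.trans ((hZ.around hk'').nsmul e)).trans b1
  have r2 := b2.trans f2
  obtain ⟨w', y', g1, g2, g3, g4, g5, g6⟩ := r1.fn2 r2
  have hlen : p + e * c + p' + (q' + q) = t := by
    have : c * (e + 1) = e * c + c := by ring
    omega
  have hlenR : (p : ℝ) + e * c + c + q = t := by
    rw [← hlen, ← b3]; push_cast; ring
  rw [hlen] at g1 g5 g6
  refine ⟨w', y', g1, g2, g5, g3, ?_, _, by omega, g4⟩
  rw [g6]
  simp only [Nat.cast_zero, zero_mul, sub_zero, hy0] at f5
  have : z2 = c * m - z1 := by linarith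
  rw [this, hm]
  rw [← hlenR] at f5
  linarith

theorem cyc_mean_le {n : ℕ} {A : MPMat n} {lam : ℝ}
    (hlam : ∀ W m, IsCycleIn (digr A) W → meanIs A W m → m ≤ lam)
    (c : ℕ) (w : ℕ → Fin n) (y : ℕ → ℝ) (h : Cyc A c w y) : y c ≤ c * lam := by
  obtain ⟨W, hW, hl, hw, -⟩ := list_of_cyc h
  have hc : (0:ℝ) < c := by exact_mod_cast h.1
  have := hlam W (y c / c) hW (by
    unfold meanIs elen
    rw [hw, hl]
    congr 1
    simp; field_simp)
  rw [div_le_iff₀ hc] at this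
  linarith

theorem closed0 {n : ℕ} {A : MPMat n} {lam : ℝ}
    (hlam : ∀ W m, IsCycleIn (digr A) W → meanIs A W m → m ≤ lam)
    (c : ℕ) (i : Fin n) (x : ℝ) (h : Wk (shiftMat A (-lam)) i i c x) : x ≤ 0 := by
  have := closed_le (cyc_mean_le hlam) _ _ _ h.unshift
  linarith

theorem digr_shift {n : ℕ} (A : MPMat n) (c : ℝ) : digr (shiftMat A c) = digr A := by
  unfold digr shiftMat
  congr 1
  funext i j
  simp

theorem wk_short {n : ℕ} {M : MPMat n} (hM : ∀ c i x, Wk M i i c x → x ≤ 0) {i j : Fin n} :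
    ∀ (t : ℕ) (x : ℝ), Wk M i j t x → ∃ t' < n, ∃ x', x ≤ x' ∧ Wk M i j t' x' := by
  intro t
  induction t using Nat.strong_induction_on with
  | _ t ih =>
    intro x h
    by_cases ht : t < n
    · exact ⟨t, ht, x, le_rfl, h⟩
    obtain ⟨w, y, hF, hw0, hy0, hwt, hyt⟩ := h.fn
    obtain ⟨a, ha, b, hb, hab, hw⟩ := Finset.exists_ne_map_eq_of_card_lt_of_maps_to
      (s := Finset.range (t + 1)) (t := (Finset.univ : Finset (Fin n))) (f := w)
      (by simp; omega) (by simp)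
    have main : ∃ s e, s < e ∧ e ≤ t ∧ w s = w e := by
      simp only [Finset.mem_range] at ha hb
      rcases lt_or_gt_of_ne hab with hh | hh
      · exact ⟨a, b, hh, by omega, hw⟩
      · exact ⟨b, a, hh, by omega, hw.symm⟩
    obtain ⟨s, e, hse, het, hw⟩ := main
    have s1 := hF.seg (Nat.zero_le s) (by omega)
    have s2 := hF.seg hse.le het
    have s3 := hF.seg het le_rfl
    rw [← hw] at s2 s3
    have := hM _ _ _ s2
    rw [hw0] at s1
    rw [hwt] at s3
    obtain ⟨t', ht', x', hx', hh⟩ := ih _ (by omega) _ (s1.trans s3)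
    exact ⟨t', ht', x', by linarith, hh⟩

theorem wk_bdd {n : ℕ} {M : MPMat n} (hM : ∀ c i x, Wk M i i c x → x ≤ 0) :
    ∃ K : ℝ, ∀ i j t x, Wk M i j t x → x ≤ K := by
  obtain ⟨B, hB⟩ := (Set.finite_range (fun p : Fin n × Fin n × Fin n => mpPow M p.1 p.2.1 p.2.2)).bddAbove
  refine ⟨B.unbotD 0, ?_⟩
  intro i j t x h
  obtain ⟨t', ht', x', hx, h'⟩ := wk_short hM t x h
  have := h'.le_pow.trans (hB ⟨(⟨t', ht'⟩, i, j), rfl⟩)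
  cases B with
  | bot => simp at this
  | coe b =>
    have := WithBot.coe_le_coe.1 this
    simp; linarith

theorem le_csrM {n : ℕ} {A : MPMat n} {lam : ℝ} {G : SubD n}
    (hM : ∀ c i x, Wk (shiftMat A (-lam)) i i c x → x ≤ 0) {i j : Fin n} {m : ℕ} {x : ℝ}
    (h : Wk (shiftMat A (-lam)) i j (m * graphCyclicity G) x) : (x : WithBot ℝ) ≤ csrM A lam G i j := by
  obtain ⟨K, hK⟩ := wk_bdd hM
  refine h.le_powpow.trans (le_ciSup (f := fun t => mpPow (mpPow (shiftMat A (-lam)) (graphCyclicity G)) t i j) ?_ m)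
  refine ⟨(K : WithBot ℝ), ?_⟩
  rintro _ ⟨t, rfl⟩
  refine pow_le ?_
  intro x hx
  exact WithBot.coe_le_coe.2 (hK _ _ _ _ (wk_powpow hx))

theorem csrM_add_le {n : ℕ} {A : MPMat n} {lam : ℝ} {G : SubD n} {i j : Fin n} {c y : WithBot ℝ}
    (h : ∀ m x, Wk (shiftMat A (-lam)) i j (m * graphCyclicity G) x → (x : WithBot ℝ) + c ≤ y) :
    csrM A lam G i j + c ≤ y := by
  cases c with
  | bot => simp
  | coe r =>
    have : csrM A lam G i j ≤ y + ((-r : ℝ) : WithBot ℝ) := by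
      refine ciSup_le ?_
      intro m
      refine pow_le ?_
      intro x hx
      have := h m x (wk_powpow hx)
      cases y with
      | bot => rw [← WithBot.coe_add] at this; simp at this
      | coe y =>
        rw [← WithBot.coe_add] at this ⊢
        have := WithBot.coe_le_coe.1 this
        apply WithBot.coe_le_coe.2
        linarith
    refine (add_le_add_left this _).trans ?_
    rw [add_assoc, ← WithBot.coe_add]
    simp

theorem csrS_sub {n : ℕ} {A : MPMat n} {lam : ℝ} {G : SubD n} (i j : Fin n) (a : ℝ)
    (h : csrS A lam G i j = (a : WithBot ℝ)) : shiftMat A (-lam) i j = (a : WithBot ℝ) := by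
  unfold csrS at h
  split_ifs at h
  · exact h
  · simp at h

theorem csrS_mono {n : ℕ} {A : MPMat n} {lam : ℝ} {G H : SubD n} (hGH : SubLE G H) (i j : Fin n) (a : ℝ)
    (h : csrS A lam G i j = (a : WithBot ℝ)) : csrS A lam H i j = (a : WithBot ℝ) := by
  unfold csrS at h ⊢
  split_ifs at h with h1
  · rw [if_pos (hGH.2 _ _ h1)]; exact h
  · simp at h

theorem crit_edge {n : ℕ} {A : MPMat n} {lam : ℝ} {u v : Fin n} (h : critEdges A lam u v) :
    ∃ a : ℝ, shiftMat A (-lam) u v = (a : WithBot ℝ) ∧ ∃ t', Wk (shiftMat A (-lam)) v u t' (-a) := by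
  obtain ⟨W, hW, hm, he⟩ := h
  obtain ⟨c, w, y, hC, hl, hw, -, -, h3⟩ := cyc_of_list hW
  obtain ⟨k, hk, rfl, rfl⟩ := h3 _ _ he
  have hm' : y c = c * lam := by
    unfold meanIs elen at hm
    rw [hw, hl] at hm
    have := WithBot.coe_injective hm
    simpa using this
  have s0 := hC.2.1 k hk
  have s1 := hC.2.1.seg (show k + 1 ≤ c by omega) le_rfl
  have s2 := hC.2.1.seg (Nat.zero_le k) (by omega)
  rw [hC.2.2.1] at s1
  refine ⟨y (k + 1) - y k + -lam, by simp only [shiftMat]; rw [s0, ← WithBot.coe_add], _, ((s1.trans s2).shift (-lam)).cast rfl ?_⟩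
  have : ((c - (k + 1) + (k - 0) : ℕ) : ℝ) = c - 1 := by
    have : c - (k + 1) + (k - 0) + 1 = c := by omega
    have : (((c - (k + 1) + (k - 0)) + 1 : ℕ) : ℝ) = c := by rw [this]
    push_cast at this ⊢; linarith
  rw [this, hm', hC.2.2.2.2]; ring

theorem crit_rev {n : ℕ} {A : MPMat n} {lam : ℝ} {u v : Fin n} {t : ℕ} {x : ℝ}
    (h : Wk (csrS A lam (critSub A lam)) u v t x) : ∃ t', Wk (shiftMat A (-lam)) v u t' (-x) := by
  induction h with
  | nil i => exact ⟨0, (Wk.nil i).cast rfl (by simp)⟩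
  | @cons i j k t x a ha hw ih =>
    obtain ⟨t', h'⟩ := ih
    have he : critEdges A lam i j := by
      unfold csrS at ha
      split_ifs at ha with h1
      · exact h1
      · simp at ha
    obtain ⟨a', h1, t'', h2⟩ := crit_edge he
    rw [csrS_sub _ _ _ ha] at h1
    have := WithBot.coe_injective h1
    subst this
    exact ⟨_, (h'.trans h2).cast rfl (by ring)⟩

theorem crit_closed {n : ℕ} {A : MPMat n} {lam : ℝ}
    (hM : ∀ c i x, Wk (shiftMat A (-lam)) i i c x → x ≤ 0) {u : Fin n} {t : ℕ} {x : ℝ}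
    (h : Wk (csrS A lam (critSub A lam)) u u t x) : x = 0 := by
  obtain ⟨t', h'⟩ := crit_rev h
  have := hM _ _ _ h'
  have := hM _ _ _ (h.mono csrS_sub)
  linarith

theorem csrS_ne {n : ℕ} {A : MPMat n} {lam : ℝ} {G : SubD n} (hG : SubLE G (critSub A lam))
    (u v : Fin n) (h : G.edge u v) : csrS A lam G u v ≠ ⊥ := by
  obtain ⟨a, ha, -⟩ := crit_edge (hG.2 _ _ h)
  unfold csrS
  rw [if_pos h]
  intro h'
  rw [shiftMat, h'] at ha
  simp at ha

theorem wk_of_walk {n : ℕ} {A : MPMat n} {lam : ℝ} {G : SubD n} (hG : SubLE G (critSub A lam))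
    {W : List (Fin n)} {u v : Fin n}
    (hW : IsWalkIn G W) (hu : W.head? = some u) (hv : W.getLast? = some v) :
    ∃ x, Wk (csrS A lam G) u v (elen W) x := by
  obtain ⟨y, h0, hF, -⟩ := list_fn (csrS A lam G) u W hW.1 (List.IsChain.imp (csrS_ne hG) hW.2.2)
  have := hF.seg (Nat.zero_le _) le_rfl
  have e1 : W.getD 0 u = u := by
    rw [List.head?_eq_getElem?] at hu; simp [hu]
  have e2 : W.getD (W.length - 1) u = v := by
    rw [List.getLast?_eq_getElem?] at hv; simp [hv]
  rw [e1, e2] at this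
  exact ⟨_, this.cast (by simp [elen]) rfl⟩

theorem cyc_of_walk {n : ℕ} {A : MPMat n} {lam : ℝ} {G : SubD n} (hG : SubLE G (critSub A lam))
    (hM : ∀ c i x, Wk (shiftMat A (-lam)) i i c x → x ≤ 0)
    {W : List (Fin n)} {u : Fin n} (hW : IsCycleIn G W) (hu : u ∈ W) :
    ∃ c w y k, Cyc (csrS A lam G) c w y ∧ Cyc (shiftMat A (-lam)) c w y ∧ y c = 0 ∧ k < c ∧ w k = u := by
  have hW' : IsCycleIn (digr (csrS A lam G)) W :=
    ⟨⟨hW.1.1, fun v _ => Set.mem_univ v, List.IsChain.imp (csrS_ne hG) hW.1.2.2⟩, hW.2⟩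
  obtain ⟨c, w, y, hC, -, -, h1, -⟩ := cyc_of_list hW'
  obtain ⟨k, hk, hku⟩ := h1 u hu
  refine ⟨c, w, y, k, hC, ⟨hC.1, fun k hk => csrS_sub _ _ _ (hC.2.1 k hk), hC.2.2⟩, ?_, hk, hku⟩
  exact crit_closed hM ((hC.around hk).mono (csrS_mono hG))

theorem int_gen (K : AddSubgroup ℤ) : ∃ g : ℕ, ∀ z : ℤ, z ∈ K ↔ (g : ℤ) ∣ z := by
  obtain ⟨g, hg⟩ := Int.subgroup_cyclic K
  refine ⟨g.natAbs, fun z => ?_⟩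
  rw [hg, AddSubgroup.mem_closure_singleton, Int.natAbs_dvd]
  constructor
  · rintro ⟨m, rfl⟩; simp
  · rintro ⟨m, rfl⟩; exact ⟨m, by simp [mul_comm]⟩

theorem setGcd_spec (S : Set ℕ) : (∀ s ∈ S, setGcd S ∣ s) ∧
    ∀ e, (∀ s ∈ S, e ∣ s) → e ∣ setGcd S := by
  refine Nat.sInf_mem (s := {d | (∀ s ∈ S, d ∣ s) ∧ ∀ e, (∀ s ∈ S, e ∣ s) → e ∣ d}) ?_
  obtain ⟨g, hg⟩ := int_gen (AddSubgroup.closure ((fun s : ℕ => (s : ℤ)) '' S))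
  refine ⟨g, ?_, ?_⟩
  · intro s hs
    have := (hg s).1 (AddSubgroup.subset_closure ⟨s, hs, rfl⟩)
    exact_mod_cast this
  · intro e he
    have : AddSubgroup.closure ((fun s : ℕ => (s : ℤ)) '' S) ≤ AddSubgroup.zmultiples (e : ℤ) := by
      rw [AddSubgroup.closure_le]
      rintro _ ⟨s, hs, rfl⟩
      exact Int.mem_zmultiples_iff.2 (Int.natCast_dvd_natCast.2 (he s hs))
    have h := Int.mem_zmultiples_iff.1 (this ((hg g).2 dvd_rfl))
    exact_mod_cast h

theorem cyclicity_spec {n : ℕ} (G : SubD n) : 0 < graphCyclicity G ∧ ∀ v ∈ G.verts,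
    0 < sccCyclicity G v → sccCyclicity G v ∣ graphCyclicity G := by
  have := Nat.sInf_mem (s := {m | 0 < m ∧ ∀ s ∈ {c | ∃ v ∈ G.verts, c = sccCyclicity G v ∧ 0 < c}, s ∣ m}) ?_
  · exact ⟨this.1, fun v hv h => this.2 _ ⟨v, hv, rfl, h⟩⟩
  · refine ⟨∏ v : Fin n, if 0 < sccCyclicity G v then sccCyclicity G v else 1, ?_, ?_⟩
    · apply Finset.prod_pos
      intro v _
      split_ifs with h
      · exact h
      · exact one_pos
    · rintro _ ⟨v, hv, rfl, h⟩
      have := Finset.dvd_prod_of_mem (fun v : Fin n => if 0 < sccCyclicity G v then sccCyclicity G v else 1)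
        (Finset.mem_univ v)
      simpa [h] using this

theorem close_len {n : ℕ} {A : MPMat n} {lam : ℝ} {G : SubD n} (hG : SubLE G (critSub A lam))
    {k : Fin n} (hk : k ∈ G.verts) {W : List (Fin n)} (hWc : IsCycleIn G W) (hkW : k ∈ W)
    {ℓ : ℕ} {xl : ℝ} (hl : 1 ≤ ℓ) (hW : Wk (csrS A lam G) k k ℓ xl)
    {N : ℕ} (hN : graphCyclicity G ∣ N) :
    ∃ l x, Wk (csrS A lam G) k k l x ∧ ℓ ∣ l + N := by
  let H : Set ℕ := {l | ∃ x, Wk (csrS A lam G) k k l x}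
  have H0 : 0 ∈ H := ⟨0, Wk.nil k⟩
  have Hadd : ∀ a b, a ∈ H → b ∈ H → a + b ∈ H := by
    rintro a b ⟨x, h⟩ ⟨x', h'⟩
    exact ⟨_, h.trans h'⟩
  let K : AddSubgroup ℤ :=
    { carrier := {z | ∃ a ∈ H, ∃ b ∈ H, z = (a : ℤ) - b}
      zero_mem' := ⟨0, H0, 0, H0, by simp⟩
      add_mem' := by
        rintro _ _ ⟨a, ha, b, hb, rfl⟩ ⟨a', ha', b', hb', rfl⟩
        exact ⟨_, Hadd _ _ ha ha', _, Hadd _ _ hb hb', by push_cast; ring⟩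
      neg_mem' := by
        rintro _ ⟨a, ha, b, hb, rfl⟩
        exact ⟨b, hb, a, ha, by ring⟩ }
  obtain ⟨g, hg⟩ := int_gen K
  set S : Set ℕ := {l | 0 < l ∧ ∃ W, IsClosedWalkAt G k W ∧ elen W = l} with hS
  have hgS : g ∣ sccCyclicity G k := by
    refine (setGcd_spec S).2 g ?_
    rintro l ⟨hl0, W, hWc, rfl⟩
    have := (hg (elen W)).1 ⟨elen W, wk_of_walk hG hWc.1 hWc.2.1 hWc.2.2, 0, H0, by simp⟩
    exact_mod_cast this
  have hpos : 0 < sccCyclicity G k := by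
    by_contra h0
    have h0 : sccCyclicity G k = 0 := by omega
    have hz : ∀ s ∈ S, s = 0 := by
      intro s hs
      have := (setGcd_spec S).1 s hs
      rw [show setGcd S = 0 from h0] at this
      simpa using this
    -- rotate the cycle to start at k
    obtain ⟨W', hW', hlen⟩ : ∃ W', IsClosedWalkAt G k W' ∧ 0 < elen W' := by
      obtain ⟨⟨hne, hv, hch⟩, hlen, hhl, hnd⟩ := hWc
      obtain ⟨s, r, rfl⟩ := List.append_of_mem hkW
      have hch : (s ++ k :: r).IsChain G.edge := hch
      cases s with
      | nil =>
        refine ⟨k :: r, ⟨⟨by simp, hv, hch⟩, by simp, ?_⟩, ?_⟩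
        · exact hhl.symm
        · simp [elen] at hlen ⊢; omega
      | cons a s =>
        cases r using List.reverseRecOn with
        | nil =>
          refine ⟨a :: s ++ [k], ⟨⟨by simp, hv, hch⟩, ?_, List.getLast?_concat⟩, by simp [elen]⟩
          rw [hhl]; exact List.getLast?_concat
        | append_singleton r b _ =>
          have hba : b = a := by
            have h' := hhl
            rw [show a :: s ++ k :: (r ++ [b]) = (a :: s ++ k :: r) ++ [b] by simp, List.getLast?_append] at h'
            simp at h'
            exact h'.symm
          subst hba
          refine ⟨k :: (r ++ [b]) ++ s ++ [k], ⟨⟨by simp, ?_, ?_⟩, by simp, List.getLast?_concat⟩, by simp [elen]⟩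
          · intro v hv'
            apply hv
            simp at hv' ⊢
            tauto
          · have c1 := hch.right_of_append
            have c2 : (b :: s ++ [k]).IsChain G.edge := by
              rw [show b :: s ++ k :: (r ++ [b]) = (b :: s ++ [k]) ++ (r ++ [b]) by simp] at hch
              exact hch.left_of_append
            rw [show k :: (r ++ [b]) ++ s ++ [k] = (k :: r) ++ (b :: (s ++ [k])) by simp]
            exact List.isChain_split.2 ⟨by simpa using c1, by simpa using c2⟩
    have := hz _ ⟨hlen, W', hW', rfl⟩
    omega
  have hgN : (g : ℤ) ∣ N := by
    exact_mod_cast hgS.trans (((cyclicity_spec G).2 k hk hpos).trans hN)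
  obtain ⟨a, ⟨xa, ha⟩, b, ⟨xb, hb⟩, hab⟩ := (hg N).2 hgN
  refine ⟨_, _, hb.trans (ha.nsmul (ℓ - 1)), a, ?_⟩
  obtain ⟨m, rfl⟩ : ∃ m, ℓ = m + 1 := ⟨ℓ - 1, by omega⟩
  simp only [Nat.add_sub_cancel]
  have : N + b = a := by omega
  rw [← this]; ring

theorem csr_upper {n : ℕ} {A : MPMat n} {lam : ℝ} {G : SubD n}
    (hM : ∀ c i x, Wk (shiftMat A (-lam)) i i c x → x ≤ 0)
    (hG : IsRepresenting (critSub A lam) G) {t : ℕ}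
    (hT : LenOK n t (circumf (digr A)) (cabDiam (digr A))) (i j : Fin n) :
    csr A lam G t i j + (((t : ℝ) * lam : ℝ) : WithBot ℝ) ≤ mpPow A t i j := by
  unfold csr
  obtain ⟨l, hl⟩ := mpMul_attain (mpMul (csrC A lam G) (mpPow (csrS A lam G) t)) (csrR A lam G) i j
  obtain ⟨k, hk⟩ := mpMul_attain (csrC A lam G) (mpPow (csrS A lam G) t) i l
  rw [hl, hk]
  unfold csrC csrR
  split_ifs with hkG hlG
  rotate_left
  · simp
  · simp
  · simp
  rcases hs : mpPow (csrS A lam G) t k l with _ | s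
  · exact le_of_eq_of_le (by change _ + ⊥ + _ + _ = _; simp) bot_le
  change csrM A lam G i k + (s : WithBot ℝ) + csrM A lam G l j + (((t : ℝ) * lam : ℝ) : WithBot ℝ) ≤ _
  rw [show csrM A lam G i k + (s : WithBot ℝ) + csrM A lam G l j + (((t : ℝ) * lam : ℝ) : WithBot ℝ)
    = csrM A lam G i k + ((s : WithBot ℝ) + csrM A lam G l j + (((t : ℝ) * lam : ℝ) : WithBot ℝ)) by
      simp only [add_assoc]]
  refine csrM_add_le ?_
  intro m x hx
  rw [show (x : WithBot ℝ) + ((s : WithBot ℝ) + csrM A lam G l j + (((t : ℝ) * lam : ℝ) : WithBot ℝ))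
    = csrM A lam G l j + (((x + s + t * lam : ℝ)) : WithBot ℝ) by push_cast; ac_rfl]
  refine csrM_add_le ?_
  intro m' x' hx'
  have hS := wk_of_pow hs
  obtain ⟨W, hWc, hkW⟩ := hG.noTriv k hkG
  obtain ⟨c, w, y, b, hC, hC', hy, hb, hbk⟩ := cyc_of_walk hG.le hM hWc hkW
  have har := hC.around hb
  rw [hbk] at har
  obtain ⟨l0, x0, hl0, hdvd⟩ := close_len hG.le hkG hWc hkW hC.1 har
    (N := m * graphCyclicity G + m' * graphCyclicity G)
    (dvd_add (Dvd.intro_left _ rfl) (Dvd.intro_left _ rfl))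
  have hx0 := crit_closed hM (hl0.mono (csrS_mono hG.le))
  subst hx0
  have hT' : LenOK n t (circumf (digr (shiftMat A (-lam)))) (cabDiam (digr (shiftMat A (-lam)))) := by
    rw [digr_shift]; exact hT
  have w2 := ((hl0.trans hS).mono csrS_sub).trans hx'
  subst hbk
  obtain ⟨z, hz, hz'⟩ := adjust hM hC' hy hT' _ _ _ _ _ b hb rfl hx w2 (by
    have : m * graphCyclicity G + (l0 + t + m' * graphCyclicity G)
      = (l0 + (m * graphCyclicity G + m' * graphCyclicity G)) + t := by ring
    rw [this]
    have := (Nat.modEq_zero_iff_dvd.2 hdvd).add_right t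
    simpa using this)
  refine le_trans ?_ hz'.unshift.le_pow
  rw [← WithBot.coe_add]
  apply WithBot.coe_le_coe.2
  linarith

theorem edge_verts {n : ℕ} {G : SubD n} (hcr : CompletelyReducible G) {u v : Fin n} (h : G.edge u v) :
    u ∈ G.verts ∧ v ∈ G.verts := by
  obtain ⟨W, hW, h1, h2⟩ := hcr u v h
  exact ⟨hW.2.1 _ (List.mem_of_getLast? h2), hW.2.1 _ (List.mem_of_head? h1)⟩

theorem wk_mem {n : ℕ} {A : MPMat n} {lam : ℝ} {G : SubD n} (hcr : CompletelyReducible G) {u v : Fin n}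
    {t : ℕ} {x : ℝ} (h : Wk (csrS A lam G) u v t x) (hu : u ∈ G.verts) : v ∈ G.verts := by
  induction h with
  | nil i => exact hu
  | @cons i j k t x a ha hw ih =>
    apply ih
    unfold csrS at ha
    split_ifs at ha with h1
    · exact (edge_verts hcr h1).2
    · simp at ha

theorem csr_lower {n : ℕ} {A : MPMat n} {lam : ℝ} {G : SubD n}
    (hM : ∀ c i x, Wk (shiftMat A (-lam)) i i c x → x ≤ 0)
    (hG : IsRepresenting (critSub A lam) G) {t1 t2 : ℕ} {i j v : Fin n} {x1 x2 : ℝ}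
    (h1 : Wk (shiftMat A (-lam)) i v t1 x1) (h2 : Wk (shiftMat A (-lam)) v j t2 x2)
    (hv : v ∈ critNodes A lam) :
    ((x1 + x2 : ℝ) : WithBot ℝ) ≤ csr A lam G (t1 + t2) i j := by
  obtain ⟨u, hu, ⟨Wp, hWp, hp1, hp2⟩, ⟨Wq, hWq, hq1, hq2⟩⟩ := hG.covers v hv
  have hself : SubLE (critSub A lam) (critSub A lam) := ⟨subset_rfl, fun _ _ h => h⟩
  obtain ⟨a, hp⟩ := wk_of_walk hself hWp hp1 hp2
  obtain ⟨b, hq⟩ := wk_of_walk hself hWq hq1 hq2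
  generalize elen Wp = p at hp
  generalize elen Wq = q at hq
  have hab := crit_closed hM (hp.trans hq)
  obtain ⟨W, hWc, huW⟩ := hG.noTriv u hu
  obtain ⟨c, w, y, k, hC, hC', hy, hk, hku⟩ := cyc_of_walk hG.le hM hWc huW
  have har := hC.around hk
  rw [hku] at har
  have hγ := (cyclicity_spec G).1
  obtain ⟨g, hg⟩ : ∃ g, graphCyclicity G = g + 1 := ⟨graphCyclicity G - 1, by omega⟩
  set t := t1 + t2 with ht
  set d := g * (t1 + p) with hd
  have hc1 := hC.1
  have hbig : d + t ≤ (d + t) * (g + 1) * c := by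
    rw [mul_assoc]
    exact Nat.le_mul_of_pos_right _ (by positivity)
  obtain ⟨e, he⟩ := Nat.exists_eq_add_of_le hbig
  have hbig2 : t1 ≤ (d + t) * c := by
    have : d + t ≤ (d + t) * c := Nat.le_mul_of_pos_right _ (by omega)
    omega
  obtain ⟨X, hX⟩ := Nat.exists_eq_add_of_le hbig2
  obtain ⟨ud, xd, xr, s1, s2, hs⟩ := ((har.nsmul ((d + t) * (g + 1))).cast (t' := d + (t + e)) (by omega) rfl).split
  obtain ⟨ut, xt, xe, s3, s4, hs'⟩ := s2.split
  have hz := crit_closed hM ((s1.trans s2).mono (csrS_mono hG.le))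
  have hud := wk_mem hG.compRed s1 hu
  have hut := wk_mem hG.compRed s3 hud
  have P1 := (h1.trans (hp.mono csrS_sub)).trans (s1.mono csrS_sub)
  have P3 := (((s4.mono csrS_sub).trans (hq.mono csrS_sub)).trans
    (((hp.trans hq).mono csrS_sub).nsmul g)).trans h2
  have L1 := le_csrM (G := G) hM (m := t1 + p) (P1.cast (by rw [hg, hd]; ring) rfl)
  have L3 := le_csrM (G := G) hM (m := X + q) (P3.cast (by
    rw [hg]
    zify at he hX hd ht ⊢
    linear_combination (-1) * he + (g + 1 : ℤ) * hX - hd - ht) rfl)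
  have L2 := s3.le_pow
  unfold csr
  refine le_trans ?_ (le_mpMul _ _ i j ut)
  refine le_trans ?_ (add_le_add_left (le_mpMul _ _ i ut ud) _)
  unfold csrC csrR
  rw [if_pos hud, if_pos hut]
  refine le_trans ?_ (add_le_add (add_le_add L1 L2) L3)
  rw [← WithBot.coe_add, ← WithBot.coe_add]
  apply WithBot.coe_le_coe.2
  rw [hab]
  linarith

theorem reach_mk {n : ℕ} {G : SubD n} (hv : ∀ a b, G.edge a b → b ∈ G.verts) {u v : Fin n}
    (hu : u ∈ G.verts) (h : Relation.ReflTransGen G.edge u v) : ReachIn G u v := by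
  induction h with
  | refl => exact ⟨[u], ⟨by simp, by simpa using hu, List.isChain_singleton u⟩, rfl, rfl⟩
  | @tail b c _ hbc ih =>
    obtain ⟨W, ⟨hne, hvs, hch⟩, h1, h2⟩ := ih
    refine ⟨W ++ [c], ⟨by simp, ?_, ?_⟩, ?_, List.getLast?_concat⟩
    · intro x hx
      rcases List.mem_append.1 hx with h | h
      · exact hvs x h
      · rw [List.mem_singleton] at h
        subst h; exact hv _ _ hbc
    · refine List.IsChain.append hch (List.isChain_singleton c) ?_
      intro x hx y hy
      rw [h2] at hx
      simp at hx hy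
      subst hx; subst hy; exact hbc
    · rw [List.head?_append, h1]; rfl

theorem reach_out {n : ℕ} {G : SubD n} {u v : Fin n} (h : ReachIn G u v) :
    u ∈ G.verts ∧ Relation.ReflTransGen G.edge u v := by
  obtain ⟨W, ⟨hne, hvs, hch⟩, h1, h2⟩ := h
  refine ⟨hvs _ (List.mem_of_head? h1), ?_⟩
  cases W with
  | nil => exact absurd rfl hne
  | cons a l =>
    simp at h1
    subst h1
    refine List.relationReflTransGen_of_exists_isChain_cons l hch ?_
    rw [List.getLast?_eq_some_getLast (by simp)] at h2
    exact Option.some_injective _ h2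

theorem cyc_edge {n : ℕ} {A : MPMat n} {W : List (Fin n)} (hW : IsCycleIn (digr A) W) {u v : Fin n}
    (h : (u, v) ∈ W.zip W.tail) : A u v ≠ ⊥ := by
  obtain ⟨c, w, y, hC, -, -, -, -, h3⟩ := cyc_of_list hW
  obtain ⟨k, hk, rfl, rfl⟩ := h3 _ _ h
  rw [hC.2.1 k hk]
  exact WithBot.coe_ne_bot

theorem thr_verts {n : ℕ} {A : MPMat n} {ν : WithBot ℝ} (a b : Fin n) (h : (thrCT A ν).edge a b) :
    b ∈ (thrCT A ν).verts := by
  unfold thrCT at h ⊢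
  split_ifs at h ⊢ with hν
  · exact Set.mem_univ b
  · obtain ⟨W, m, h1, h2, h3, h4⟩ := h
    exact ⟨W, m, h1, h2, h3, List.mem_of_mem_tail (List.of_mem_zip h4).2⟩

theorem thr_mono {n : ℕ} {A : MPMat n} {ν ν' : WithBot ℝ} (h : ν ≤ ν') :
    SubLE (thrCT A ν') (thrCT A ν) := by
  by_cases hν : ν = ⊥
  · subst hν
    refine ⟨by simp [thrCT, digr], ?_⟩
    intro u v he
    have : (thrCT A ⊥).edge u v ↔ A u v ≠ ⊥ := by simp [thrCT, digr]
    rw [this]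
    unfold thrCT at he
    split_ifs at he
    · exact he
    · obtain ⟨W, m, h1, h2, h3, h4⟩ := he
      exact cyc_edge h1 h4
  · have hν' : ν' ≠ ⊥ := fun h' => hν (by subst h'; simpa using h)
    unfold thrCT
    rw [if_neg hν, if_neg hν']
    refine ⟨?_, ?_⟩
    · rintro v ⟨W, m, h1, h2, h3, h4⟩
      exact ⟨W, m, h1, h2, h.trans h3, h4⟩
    · rintro u v ⟨W, m, h1, h2, h3, h4⟩
      exact ⟨W, m, h1, h2, h.trans h3, h4⟩

theorem mean_of_cyc {n : ℕ} {A : MPMat n} {c : ℕ} {w : ℕ → Fin n} {y : ℕ → ℝ} (h : Cyc A c w y) :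
    ∃ W, IsCycleIn (digr A) W ∧ meanIs A W (y c / c) ∧ (∀ k ≤ c, w k ∈ W) := by
  obtain ⟨W, hW, hl, hw, h1, -⟩ := list_of_cyc h
  have hc : (0:ℝ) < c := by exact_mod_cast h.1
  refine ⟨W, hW, ?_, h1⟩
  unfold meanIs elen
  rw [hw, hl]
  congr 1
  simp; field_simp

theorem wk_of_reach {n : ℕ} {A : MPMat n} {u v : Fin n}
    (h : Relation.ReflTransGen (fun i j => A i j ≠ ⊥) u v) : ∃ t x, Wk A u v t x := by
  induction h with
  | refl => exact ⟨0, 0, Wk.nil u⟩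
  | tail _ hbc ih =>
    obtain ⟨t, x, h⟩ := ih
    obtain ⟨r, hr⟩ := WithBot.ne_bot_iff_exists.1 hbc
    exact ⟨_, _, h.trans (Wk.single hr.symm)⟩

theorem ct_cyc {n : ℕ} {A : MPMat n} {lam : ℝ} {μ : WithBot ℝ} {v : Fin n} (h : v ∈ ctNodes A lam μ) :
    ∃ W m, IsCycleIn (digr A) W ∧ meanIs A W m ∧ μ ≤ ((m : ℝ) : WithBot ℝ) ∧ v ∈ W := by
  obtain ⟨hv, w, hw, h1, h2⟩ := h
  by_cases hμ : μ = ⊥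
  · subst hμ
    by_cases hvw : v = w
    · obtain ⟨W, a, b, c⟩ := hw
      exact ⟨W, lam, a, b, bot_le, by rw [hvw]; exact c⟩
    · have e1 := (reach_out h1).2
      have e2 := (reach_out h2).2
      have hE : (thrCT A ⊥).edge = fun i j => A i j ≠ ⊥ := by simp [thrCT, digr]
      rw [hE] at e1 e2
      obtain ⟨t, x, k1⟩ := wk_of_reach e1
      obtain ⟨t', x', k2⟩ := wk_of_reach e2
      have ht : 0 < t := by
        rcases Nat.eq_zero_or_pos t with h | h
        · subst h
          cases k1
          exact absurd rfl hvw
        · exact h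
      obtain ⟨c, f, y, hC, h0⟩ := exists_cyc_of_closed _ _ _ (by omega) (k1.trans k2)
      obtain ⟨W, hW, hm, hk⟩ := mean_of_cyc hC
      exact ⟨W, _, hW, hm, bot_le, by rw [← h0]; exact hk 0 (by omega)⟩
  · unfold thrCT at hv
    rw [if_neg hμ] at hv
    exact hv

theorem mean_unique {n : ℕ} {A : MPMat n} {W : List (Fin n)} {m : ℝ} {c : ℕ} {y : ℝ} (hm : meanIs A W m)
    (hl : W.length = c + 1) (hy : walkWeight A W = (y : WithBot ℝ)) : y = c * m := by
  unfold meanIs elen at hm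
  rw [hl, hy] at hm
  simpa using WithBot.coe_injective hm

theorem finite_means {n : ℕ} (A : MPMat n) : {m | ∃ W, IsCycleIn (digr A) W ∧ meanIs A W m}.Finite := by
  refine ((List.finite_length_le (Fin n) (n + 1)).image (fun W => (walkWeight A W).unbotD 0 / (elen W : ℝ))).subset ?_
  rintro m ⟨W, hW, hm⟩
  obtain ⟨c, w, y, hC, hl, hy, -⟩ := cyc_of_list hW
  refine ⟨W, ?_, ?_⟩
  · have := hC.le_card
    simp; omega
  · have := mean_unique hm hl hy
    have hc : (0:ℝ) < c := by exact_mod_cast hC.1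
    simp only [hy, elen, hl, WithBot.unbotD_coe, Nat.add_sub_cancel, this]
    field_simp

theorem main_lower {n : ℕ} {A : MPMat n} {lam : ℝ} {G : SubD n} {μ : WithBot ℝ}
    (hlam : ∀ W m, IsCycleIn (digr A) W → meanIs A W m → m ≤ lam) (hμ : IsMuCT A lam μ)
    (hG : IsRepresenting (critSub A lam) G) {t : ℕ}
    (hT : LenOK n t (circumf (digr A)) (cabDiam (digr A))) (i j : Fin n) (x : ℝ)
    (w0 : ℕ → Fin n) (y0 : ℕ → ℝ) (hF0 : Fw A t w0 y0) (hi0 : w0 0 = i) (hj0 : w0 t = j)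
    (hy0 : y0 0 = 0) (hyt0 : y0 t = x) (a0 : ℕ) (ha0 : a0 ≤ t) (hct0 : w0 a0 ∈ ctNodes A lam μ) :
    (x : WithBot ℝ) ≤ csr A lam G t i j + (((t : ℝ) * lam : ℝ) : WithBot ℝ) := by
  let Good : (ℕ → Fin n) → (ℕ → ℝ) → Prop := fun w y => Fw A t w y ∧ w 0 = i ∧ w t = j ∧ y 0 = 0 ∧
    x ≤ y t ∧ ∃ a ≤ t, w a ∈ ctNodes A lam μ
  let Ms : Set ℝ := {m | ∃ W w y, IsCycleIn (digr A) W ∧ meanIs A W m ∧ Good w y ∧ ∃ a ≤ t, w a ∈ W}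
  have hg0 : Good w0 y0 := ⟨hF0, hi0, hj0, hy0, hyt0.ge, a0, ha0, hct0⟩
  obtain ⟨W0, m0, hW0, hm0, hμ0, hin0⟩ := ct_cyc hct0
  have hm0s : m0 ∈ Ms := ⟨W0, w0, y0, hW0, hm0, hg0, a0, ha0, hin0⟩
  have hfin : Ms.Finite := (finite_means A).subset (by
    rintro m ⟨W, w, y, h1, h2, -⟩
    exact ⟨W, h1, h2⟩)
  obtain ⟨ms, hms, hmax⟩ := Set.exists_max_image Ms id hfin ⟨m0, hm0s⟩
  simp only [id] at hmax
  have hμms : μ ≤ (ms : WithBot ℝ) := hμ0.trans (WithBot.coe_le_coe.2 (hmax _ hm0s))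
  obtain ⟨Ws, ws, ys, hWs, hmWs, hgs, as, has, hins⟩ := hms
  have hmsl := hlam _ _ hWs hmWs
  have claim : ∃ w y, Good w y ∧ ∃ a ≤ t, ∃ wc ∈ critNodes A lam, SccEq (thrCT A (ms : WithBot ℝ)) (w a) wc := by
    rcases hμms.lt_or_eq with hlt | heq
    · have hnf : ¬ HasFreeScc (thrCT A (ms : WithBot ℝ)) (critSub A lam) := by
        intro hP
        rcases hμ with ⟨-, -, h⟩ | ⟨-, h⟩
        · exact absurd (h _ (WithBot.coe_le_coe.2 hmsl) hP) (not_le.2 hlt)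
        · exact h _ (WithBot.coe_le_coe.2 hmsl) hP
      unfold HasFreeScc at hnf
      push Not at hnf
      obtain ⟨wc, hwc, hsub⟩ := hnf (ws as) (by
        unfold thrCT
        rw [if_neg WithBot.coe_ne_bot]
        exact ⟨Ws, ms, hWs, hmWs, le_rfl, hins⟩)
      have hr : ReachIn (critSub A lam) wc wc :=
        ⟨[wc], ⟨by simp, by simpa using hwc, List.isChain_singleton wc⟩, rfl, rfl⟩
      exact ⟨ws, ys, hgs, as, has, wc, hwc, hsub ⟨hr, hr⟩⟩
    · obtain ⟨-, wc, hwc, hs⟩ := hct0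
      rw [heq] at hs
      exact ⟨w0, y0, hg0, a0, ha0, wc, hwc, hs⟩
  obtain ⟨w1, y1, hg1, a1, ha1, wc, hwc, hr1, hr2⟩ := claim
  have hsubΘ := thr_mono (A := A) hμms
  have step : ∀ z, Relation.ReflTransGen (thrCT A (ms : WithBot ℝ)).edge z wc →
      Relation.ReflTransGen (thrCT A (ms : WithBot ℝ)).edge wc z →
      (∃ w y, Good w y ∧ ∃ a ≤ t, w a = z) → ∃ w y, Good w y ∧ ∃ a ≤ t, w a = wc := by
    intro z hz
    induction hz using Relation.ReflTransGen.head_induction_on with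
    | refl => exact fun _ h => h
    | @head z z' hzz hrest ih =>
      intro hback ⟨w, y, hg, a, ha, haz⟩
      have hback' := hback.tail hzz
      apply ih hback'
      have hz'ct : z' ∈ ctNodes A lam μ := by
        have hz'v : z' ∈ (thrCT A μ).verts := hsubΘ.1 (thr_verts _ _ hzz)
        refine ⟨hz'v, wc, hwc, ?_, ?_⟩
        · exact reach_mk thr_verts hz'v (Relation.ReflTransGen.mono hsubΘ.2 _ _ hrest)
        · exact reach_mk thr_verts (hsubΘ.1 (reach_out hr2).1) (Relation.ReflTransGen.mono hsubΘ.2 _ _ hback')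
      have hzz2 := hzz
      unfold thrCT at hzz2
      rw [if_neg WithBot.coe_ne_bot] at hzz2
      obtain ⟨W, m, hW, hm, hmm, hmem⟩ := hzz2
      have hzW : z ∈ W := (List.of_mem_zip hmem).1
      have hm1 : m ≤ ms := hmax m ⟨W, w, y, hW, hm, hg, a, ha, by rw [haz]; exact hzW⟩
      have hm2 : m = ms := le_antisymm hm1 (WithBot.coe_le_coe.1 hmm)
      subst hm2
      obtain ⟨c, wz, yz, hC, hl, hy, -, -, hed⟩ := cyc_of_list hW
      obtain ⟨k, hk, hkz, hkz'⟩ := hed _ _ hmem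
      obtain ⟨k', hk', hkk'⟩ : ∃ k' < c, wz k' = z' := by
        by_cases h : k + 1 < c
        · exact ⟨k + 1, h, hkz'⟩
        · have : k + 1 = c := by omega
          exact ⟨0, by omega, by rw [← hC.2.2.1, ← this]; exact hkz'⟩
      obtain ⟨hF, hw0, hwt, hy0', hyt, hcta⟩ := hg
      obtain ⟨w', y', f1, f2, f3, f4, f5, a', ha', f6⟩ := improve hT hF hy0' hC (mean_unique hm hl hy)
        (by
          intro c' w' y' hC' ⟨b, hb, a'', ha'', hba⟩
          obtain ⟨W', hW', hm', hin'⟩ := mean_of_cyc hC'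
          have := hmax _ ⟨W', w, y, hW', hm', ⟨hF, hw0, hwt, hy0', hyt, hcta⟩, a'', ha'', by
            rw [← hba]; exact hin' b hb⟩
          have hc : (0:ℝ) < c' := by exact_mod_cast hC'.1
          rw [div_le_iff₀ hc] at this
          linarith) ha hk (haz.trans hkz.symm) hk'
      exact ⟨w', y', ⟨f1, f2.trans hw0, f3.trans hwt, f4, hyt.trans f5, a', ha', by
        rw [f6, hkk']; exact hz'ct⟩, a', ha', f6.trans hkk'⟩
  obtain ⟨w, y, ⟨hF, hw0, hwt, hy, hxy, -⟩, a, ha, hac⟩ := step _ (reach_out hr1).2 (reach_out hr2).2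
    ⟨w1, y1, hg1, a1, ha1, rfl⟩
  have s1 := hF.seg (Nat.zero_le a) ha
  have s2 := hF.seg ha le_rfl
  rw [hac, hw0] at s1
  rw [hac, hwt] at s2
  have := csr_lower (closed0 hlam) hG (s1.shift (-lam)) (s2.shift (-lam)) hwc
  rw [show a - 0 + (t - a) = t by omega] at this
  refine le_trans ?_ (add_le_add_left this _)
  rw [← WithBot.coe_add]
  apply WithBot.coe_le_coe.2
  have e1 : ((a - 0 : ℕ) : ℝ) = a := by simp
  have e2 : ((t - a : ℕ) : ℝ) = t - a := by push_cast [ha]; ring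
  rw [e1, e2, hy]
  linarith

theorem weak_eq {n : ℕ} {A : MPMat n} {lam : ℝ} {G : SubD n} {μ : WithBot ℝ}
    (hlam : ∀ W m, IsCycleIn (digr A) W → meanIs A W m → m ≤ lam) (hμ : IsMuCT A lam μ)
    (hG : IsRepresenting (critSub A lam) G) {t : ℕ}
    (hT : LenOK n t (circumf (digr A)) (cabDiam (digr A))) : weakCSReq A (bCT A lam μ) lam G t := by
  intro i j
  apply le_antisymm
  · refine pow_le ?_
    intro x hx
    obtain ⟨w, y, hF, hw0, hy0, hwt, hyt⟩ := hx.fn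
    by_cases h : ∃ a ≤ t, w a ∈ ctNodes A lam μ
    · obtain ⟨a, ha, hct⟩ := h
      exact le_max_of_le_left (main_lower hlam hμ hG hT i j x w y hF hw0 hwt hy0 hyt a ha hct)
    · push Not at h
      apply le_max_of_le_right
      have hF' : Fw (bCT A lam μ) t w y := by
        intro k hk
        unfold bCT zeroRC
        rw [if_neg (by rintro (h' | h'); exacts [h k hk.le h', h (k + 1) hk h'])]
        exact hF k hk
      have := hF'.seg (Nat.zero_le t) le_rfl
      rw [hw0, hwt] at this
      exact (this.cast (t' := t) (x' := x) (by simp) (by rw [hyt, hy0]; ring)).le_pow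
  · refine max_le (csr_upper (closed0 hlam) hG hT i j) (pow_le ?_)
    intro x hx
    refine (hx.mono ?_).le_pow
    intro i j a h
    unfold bCT zeroRC at h
    split_ifs at h
    · simp at h
    · exact h

/-- For `B^{ct}` the cycle threshold scheme,
`T₁(A,B^{ct}) ≤ (n−1)ĉ + min(n, cd+ĉ+1)` and
`T₁(A,B^{ct}) ≤ (cd+ĉ−1)ĉ + cd + 1`. -/
theorem weakCSR_threshold_ct_le_circumf_bounds {n : ℕ} (hn : 1 ≤ n) (A : MPMat n) (lam : ℝ)
    (hlam : IsMaxCycleMean A lam) (μ : WithBot ℝ) (hμ : IsMuCT A lam μ)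
    (G : SubD n) (hG : IsRepresenting (critSub A lam) G) :
    (∀ t : ℕ, ((n : ℤ) - 1) * (circumf (digr A) : ℤ)
        + min (n : ℤ) ((cabDiam (digr A) : ℤ) + (circumf (digr A) : ℤ) + 1) ≤ (t : ℤ) →
      weakCSReq A (bCT A lam μ) lam G t)
    ∧ (∀ t : ℕ, ((cabDiam (digr A) : ℤ) + (circumf (digr A) : ℤ) - 1) * (circumf (digr A) : ℤ)
        + (cabDiam (digr A) : ℤ) + 1 ≤ (t : ℤ) →
      weakCSReq A (bCT A lam μ) lam G t) := by
  obtain ⟨⟨W, hW, -⟩, hl⟩ := hlam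
  obtain ⟨c, w, y, hC, -⟩ := cyc_of_list hW
  have h1 : 1 ≤ circumf (digr A) := hC.1.trans hC.le_circ
  exact ⟨fun t ht => weak_eq hl hμ hG (lenOK1 h1 ht), fun t ht => weak_eq hl hμ hG (lenOK2 ht)⟩

end MaxPlus
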